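/- (Mass conservation.) Let T > 0, let φ : ℝ → ℝ be continuous and nondecreasing, let μ be a Lévy measure on ℝ^N \ {0}, and let u₀ ∈ L^∞(ℝ^N) ∩ L¹(ℝ^N). Let u be a distributional solution in L^∞(Q_T) ∩ L¹(Q_T) ∩ C([0,T]; L¹_loc(ℝ^N)) of ∂_t u − L^μ[φ(u)] = 0 in Q_T with initial datum u₀. If in addition there exist constants L, δ > 0 such that |φ(r)| ≤ L|r| for all |r| ≤ δ, then ∫_{ℝ^N} u(x,t) dx = ∫_{ℝ^N} u₀(x) dx for every t ∈ [0,T]. -/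

import Mathlib

open MeasureTheory Set Filter

noncomputable section

/-- Euclidean space `ℝ^N`. -/
abbrev Euc (N : ℕ) := EuclideanSpace ℝ (Fin N)

variable {N : ℕ}

/-- `μ` is a (symmetric) Lévy measure on `ℝ^N ∖ {0}` : it is a nonnegative measure giving no
mass to `{0}`, symmetric (`μ(−B) = μ(B)`), and `∫ min(|z|²,1) dμ(z) < ∞`. -/
def IsLevyMeasure (μ : Measure (Euc N)) : Prop :=
  μ {0} = 0 ∧ μ.map (fun z => -z) = μ ∧
    ∫⁻ z, ENNReal.ofReal (min (‖z‖ ^ 2) 1) ∂μ ≠ ⊤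

/-- The nonlocal operator
`L^μ[ψ](x) = ∫ (ψ(x+z) − ψ(x) − z·Dψ(x) 1_{|z|≤1}) dμ(z)`. -/
def Lop (μ : Measure (Euc N)) (ψ : Euc N → ℝ) (x : Euc N) : ℝ :=
  ∫ z, (ψ (x + z) - ψ x - (if ‖z‖ ≤ 1 then fderiv ℝ ψ x z else 0)) ∂μ

/-- `ψ ∈ C_c^∞(ℝ^N)`. -/
def IsTestFn (ψ : Euc N → ℝ) : Prop :=
  ContDiff ℝ (⊤ : ℕ∞) ψ ∧ HasCompactSupport ψ

/-- `ψ ∈ C_c^∞(ℝ^N × [0,T))` : smooth, compactly supported, and the support stays away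
from `t = T` (but may touch `t = 0`). -/
def IsSTTestFn (T : ℝ) (ψ : Euc N → ℝ → ℝ) : Prop :=
  ContDiff ℝ (⊤ : ℕ∞) (Function.uncurry ψ) ∧ HasCompactSupport (Function.uncurry ψ) ∧
    tsupport (Function.uncurry ψ) ⊆ {p : Euc N × ℝ | p.2 < T}

/-- `ψ ∈ C_c^∞(Q_T)` : smooth, compactly supported inside the open cylinder
`ℝ^N × (0,T)`. -/
def IsIntTestFn (T : ℝ) (ψ : Euc N → ℝ → ℝ) : Prop :=
  ContDiff ℝ (⊤ : ℕ∞) (Function.uncurry ψ) ∧ HasCompactSupport (Function.uncurry ψ) ∧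
    tsupport (Function.uncurry ψ) ⊆ {p : Euc N × ℝ | 0 < p.2 ∧ p.2 < T}

/-- The natural measure on the cylinder `Q_T = ℝ^N × (0,T)`. -/
def QTvol (N : ℕ) (T : ℝ) : Measure (Euc N × ℝ) :=
  (volume : Measure (Euc N)).prod ((volume : Measure ℝ).restrict (Ioo 0 T))

/-- `u ∈ L^∞(Q_T)`. -/
def MemLinfQT (T : ℝ) (u : Euc N → ℝ → ℝ) : Prop :=
  AEStronglyMeasurable (fun p : Euc N × ℝ => u p.1 p.2) (QTvol N T) ∧
    ∃ C : ℝ, ∀ᵐ p ∂(QTvol N T), |u p.1 p.2| ≤ C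

/-- `u ∈ L¹(Q_T)`. -/
def MemL1QT (T : ℝ) (u : Euc N → ℝ → ℝ) : Prop :=
  Integrable (fun p : Euc N × ℝ => u p.1 p.2) (QTvol N T)

/-- `u ∈ C([0,T]; L¹_loc(ℝ^N))` : for every compact `K`, `t ↦ u(·,t)` is continuous
from `[0,T]` into `L¹(K)`. -/
def MemCL1loc (T : ℝ) (u : Euc N → ℝ → ℝ) : Prop :=
  ∀ K : Set (Euc N), IsCompact K →
    (∀ t ∈ Icc (0 : ℝ) T, IntegrableOn (fun x => u x t) K) ∧
    ∀ t ∈ Icc (0 : ℝ) T,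
      Tendsto (fun s => ∫ x in K, |u x s - u x t|) (nhdsWithin t (Icc 0 T)) (nhds 0)

/-- `u` is a distributional solution of `∂_t u − A[φ(u)] = 0` in `Q_T` with initial
datum `u0` : for all `ψ ∈ C_c^∞(ℝ^N × [0,T))`,
`∫₀^T ∫ (u ∂_t ψ + φ(u) A[ψ(·,t)]) dx dt + ∫ u0(x) ψ(x,0) dx = 0`. -/
def IsDistSolOp (T : ℝ) (A : (Euc N → ℝ) → Euc N → ℝ) (φ : ℝ → ℝ)
    (u0 : Euc N → ℝ) (u : Euc N → ℝ → ℝ) : Prop :=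
  ∀ ψ : Euc N → ℝ → ℝ, IsSTTestFn T ψ →
    (∫ t in Ioo (0 : ℝ) T, ∫ x,
        (u x t * deriv (ψ x) t + φ (u x t) * A (fun y => ψ y t) x))
      + ∫ x, u0 x * ψ x 0 = 0

/-- `u0 ∈ L^∞(ℝ^N)`. -/
def MemLinfRn (u0 : Euc N → ℝ) : Prop :=
  AEStronglyMeasurable u0 (volume : Measure (Euc N)) ∧
    ∃ C : ℝ, ∀ᵐ x : Euc N ∂volume, |u0 x| ≤ C

end
noncomputable section

variable {N : ℕ}

/-- The integrand of the nonlocal operator. -/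
def levyRem (ψ : Euc N → ℝ) (x z : Euc N) : ℝ :=
  ψ (x + z) - ψ x - (if ‖z‖ ≤ 1 then fderiv ℝ ψ x z else 0)

/-- The Lévy weight `min(|z|²,1)`. -/
def levyWeight (z : Euc N) : ℝ := min (‖z‖ ^ 2) 1

theorem Lop_eq_integral_levyRem (μ : Measure (Euc N)) (ψ : Euc N → ℝ) (x : Euc N) :
    Lop μ ψ x = ∫ z, levyRem ψ x z ∂μ := rfl

theorem levyWeight_nonneg (z : Euc N) : 0 ≤ levyWeight z :=
  le_min (by positivity) zero_le_one

theorem continuous_levyWeight : Continuous (levyWeight (N := N)) := by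
  unfold levyWeight; fun_prop

theorem IsLevyMeasure.integrable_levyWeight {μ : Measure (Euc N)} (hμ : IsLevyMeasure μ) :
    Integrable (levyWeight (N := N)) μ := by
  refine ⟨continuous_levyWeight.aestronglyMeasurable, ?_⟩
  rw [hasFiniteIntegral_iff_ofReal (Eventually.of_forall levyWeight_nonneg)]
  exact lt_top_iff_ne_top.2 hμ.2.2

theorem IsLevyMeasure.integral_neg {μ : Measure (Euc N)} (hμ : IsLevyMeasure μ)
    (f : Euc N → ℝ) : ∫ z, f (-z) ∂μ = ∫ z, f z ∂μ := by
  conv_rhs => rw [← hμ.2.1]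
  exact (integral_map_equiv (MeasurableEquiv.neg (Euc N)) f).symm

theorem measurable_levyRem (ψ : Euc N → ℝ) (hψ : Continuous ψ) (x : Euc N) :
    Measurable (levyRem ψ x) := by
  unfold levyRem
  refine Measurable.sub (by fun_prop) (Measurable.ite ?_ (by fun_prop) measurable_const)
  exact (isClosed_le continuous_norm continuous_const).measurableSet

/-- First-order Taylor bound for a function whose derivative is Lipschitz. -/
theorem abs_taylor_le {ψ : Euc N → ℝ} (hψ : Differentiable ℝ ψ) {C : ℝ}
    (hC : ∀ x y, ‖fderiv ℝ ψ x - fderiv ℝ ψ y‖ ≤ C * ‖x - y‖) (x z : Euc N) :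
    |ψ (x + z) - ψ x - fderiv ℝ ψ x z| ≤ C * ‖z‖ ^ 2 := by
  have h := (convex_segment x (x + z)).norm_image_sub_le_of_norm_fderiv_le'
    (f := ψ) (φ := fderiv ℝ ψ x) (C := |C| * ‖z‖) (fun y _ => hψ y) (fun y hy => by
      obtain ⟨t, ht, rfl⟩ := (segment_eq_image' ℝ x (x + z) ▸ hy)
      refine (hC _ _).trans ?_
      have : x + t • (x + z - x) - x = t • z := by simp
      rw [this, norm_smul, Real.norm_eq_abs, abs_of_nonneg ht.1]
      have h1 : t * ‖z‖ ≤ ‖z‖ := mul_le_of_le_one_left (norm_nonneg _) ht.2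
      calc C * (t * ‖z‖) ≤ |C| * (t * ‖z‖) :=
            mul_le_mul_of_nonneg_right (le_abs_self C) (mul_nonneg ht.1 (norm_nonneg _))
        _ ≤ |C| * ‖z‖ := by gcongr)
    (left_mem_segment ℝ x (x + z)) (right_mem_segment ℝ x (x + z))
  have h2 : |ψ (x + z) - ψ x - fderiv ℝ ψ x z| ≤ |C| * ‖z‖ * ‖z‖ := by
    simpa using h
  have hz : |C| * ‖z‖ = C * ‖z‖ := by
    rcases eq_or_ne z 0 with rfl | hz
    · simp
    · have h0 := (norm_nonneg _).trans (hC z 0)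
      rw [sub_zero] at h0
      rw [abs_of_nonneg (nonneg_of_mul_nonneg_left h0 (norm_pos_iff.2 hz))]
  rw [hz] at h2
  linarith [sq ‖z‖, mul_assoc C ‖z‖ ‖z‖, congrArg (C * ·) (sq ‖z‖)]

theorem IsTestFn.exists_fderiv_lipschitz {ψ : Euc N → ℝ} (hψ : IsTestFn ψ) :
    ∃ C, 0 ≤ C ∧ ∀ x y, ‖fderiv ℝ ψ x - fderiv ℝ ψ y‖ ≤ C * ‖x - y‖ := by
  obtain ⟨C, hC⟩ := ContDiff.lipschitzWith_of_hasCompactSupport (n := 1)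
    (hψ.2.fderiv (𝕜 := ℝ)) (hψ.1.fderiv_right (m := 1) (by norm_cast)) (by simp)
  exact ⟨C, C.2, fun x y => by simpa [dist_eq_norm] using hC.dist_le_mul x y⟩

theorem IsTestFn.exists_bound {ψ : Euc N → ℝ} (hψ : IsTestFn ψ) :
    ∃ M, 0 ≤ M ∧ ∀ x, |ψ x| ≤ M := by
  obtain ⟨M, hM⟩ := hψ.2.exists_bound_of_continuous hψ.1.continuous
  exact ⟨M, (norm_nonneg _).trans (hM 0), hM⟩

theorem IsTestFn.differentiable {ψ : Euc N → ℝ} (hψ : IsTestFn ψ) : Differentiable ℝ ψ :=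
  hψ.1.differentiable (by simp)

theorem abs_levyRem_le {ψ : Euc N → ℝ} {x z : Euc N} {A B : ℝ}
    (hA : ‖z‖ ≤ 1 → |ψ (x + z) - ψ x - fderiv ℝ ψ x z| ≤ A * ‖z‖ ^ 2)
    (hB : 1 < ‖z‖ → |ψ (x + z) - ψ x| ≤ B) :
    |levyRem ψ x z| ≤ max A B * levyWeight z := by
  unfold levyRem levyWeight
  rcases le_or_gt ‖z‖ 1 with h | h
  · rw [if_pos h, min_eq_left (by nlinarith [norm_nonneg z])]
    exact (hA h).trans (by gcongr; exact le_max_left _ _)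
  · rw [if_neg h.not_ge, min_eq_right (by nlinarith [norm_nonneg z])]
    simpa using (hB h).trans (le_max_right A B)

theorem IsTestFn.exists_levyRem_bound {ψ : Euc N → ℝ} (hψ : IsTestFn ψ) :
    ∃ K, 0 ≤ K ∧ ∀ x z, |levyRem ψ x z| ≤ K * levyWeight z := by
  obtain ⟨C, hC0, hC⟩ := hψ.exists_fderiv_lipschitz
  obtain ⟨M, hM0, hM⟩ := hψ.exists_bound
  refine ⟨max C (2 * M), le_max_of_le_left hC0, fun x z => abs_levyRem_le
    (fun _ => abs_taylor_le hψ.differentiable hC x z) fun _ => ?_⟩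
  exact (abs_sub _ _).trans (by linarith [hM x, hM (x + z)])

theorem integrable_levyRem {μ : Measure (Euc N)} (hμ : IsLevyMeasure μ) {ψ : Euc N → ℝ}
    (hψ : Continuous ψ) {K : ℝ} (hK : ∀ x z, |levyRem ψ x z| ≤ K * levyWeight z) (x : Euc N) :
    Integrable (levyRem ψ x) μ :=
  (hμ.integrable_levyWeight.const_mul K).mono' (measurable_levyRem ψ hψ x).aestronglyMeasurable
    (Eventually.of_forall fun z => hK x z)

theorem abs_Lop_le {μ : Measure (Euc N)} (hμ : IsLevyMeasure μ) {ψ : Euc N → ℝ}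
    {K : ℝ} (hK : ∀ x z, |levyRem ψ x z| ≤ K * levyWeight z) (x : Euc N) :
    |Lop μ ψ x| ≤ K * ∫ z, levyWeight z ∂μ := by
  rw [Lop_eq_integral_levyRem, ← integral_const_mul]
  exact norm_integral_le_of_norm_le (f := levyRem ψ x) (hμ.integrable_levyWeight.const_mul K)
    (Eventually.of_forall fun z => hK x z)

theorem IsTestFn.continuous_Lop {μ : Measure (Euc N)} (hμ : IsLevyMeasure μ) {ψ : Euc N → ℝ}
    (hψ : IsTestFn ψ) : Continuous (Lop μ ψ) := by
  obtain ⟨K, -, hK⟩ := hψ.exists_levyRem_bound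
  have hd : Continuous (fderiv ℝ ψ) := hψ.1.continuous_fderiv (by simp)
  refine continuous_of_dominated (bound := fun z => K * levyWeight z)
    (fun x => (measurable_levyRem ψ hψ.1.continuous x).aestronglyMeasurable)
    (fun x => Eventually.of_forall fun z => hK x z) (hμ.integrable_levyWeight.const_mul K)
    (Eventually.of_forall fun z => ?_)
  have := hψ.1.continuous
  split_ifs <;> fun_prop

theorem Lop_const_mul (μ : Measure (Euc N)) {ψ : Euc N → ℝ} (hψ : Differentiable ℝ ψ) (c : ℝ)
    (x : Euc N) : Lop μ (fun y => c * ψ y) x = c * Lop μ ψ x := by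
  simp only [Lop]
  rw [← integral_const_mul]
  congr 1 with z
  rw [fderiv_const_mul (hψ x)]
  split_ifs <;> simp <;> ring

theorem exists_antideriv_test {T : ℝ} (hT : 0 < T) {ζ : ℝ → ℝ} (hζ : ContDiff ℝ (⊤ : ℕ∞) ζ)
    (hζs : HasCompactSupport ζ) (hζT : tsupport ζ ⊆ Ioo 0 T) :
    ∃ θ₀ θ : ℝ → ℝ, ContDiff ℝ (⊤ : ℕ∞) θ ∧ HasCompactSupport θ ∧ tsupport θ ⊆ Iio T ∧
      (∀ t, HasDerivAt θ₀ (ζ t) t) ∧ θ₀ T = 0 ∧ ∀ t ∈ Ico 0 T, θ =ᶠ[nhds t] θ₀ := by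
  have hd : ∀ t, HasDerivAt (fun t => (∫ s in (0 : ℝ)..t, ζ s) - ∫ s in (0 : ℝ)..T, ζ s) (ζ t) t :=
    fun t => (intervalIntegral.integral_hasDerivAt_right (hζ.continuous.intervalIntegrable _ _)
      (hζ.continuous.stronglyMeasurableAtFilter _ _) hζ.continuous.continuousAt).sub_const _
  set θ₀ : ℝ → ℝ := fun t => (∫ s in (0 : ℝ)..t, ζ s) - ∫ s in (0 : ℝ)..T, ζ s with hθ₀
  obtain ⟨a, haT, ha⟩ : ∃ a < T, ∀ t, a < t → ζ t = 0 := by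
    rcases (tsupport ζ).eq_empty_or_nonempty with he | hne
    · exact ⟨0, hT, fun t _ => image_eq_zero_of_notMem_tsupport (by simp [he])⟩
    · obtain ⟨a, haM, ha⟩ := hζs.isCompact.exists_isGreatest hne
      exact ⟨a, (hζT haM).2, fun t hat => image_eq_zero_of_notMem_tsupport
        fun h => absurd (ha h) (not_le.2 hat)⟩
  have hθa : ∀ t, a < t → θ₀ t = 0 := by
    intro t hat
    have : θ₀ t = ∫ s in T..t, ζ s :=
      intervalIntegral.integral_interval_sub_left (hζ.continuous.intervalIntegrable _ _)
        (hζ.continuous.intervalIntegrable _ _)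
    rw [this]
    refine (intervalIntegral.integral_congr (g := fun _ => 0) fun s hs => ha s ?_).trans (by simp)
    exact (lt_min haT hat).trans_le hs.1
  have hsm : ContDiff ℝ (⊤ : ℕ∞) θ₀ := by
    rw [contDiff_infty_iff_deriv]
    refine ⟨fun t => (hd t).differentiableAt, ?_⟩
    rwa [show deriv θ₀ = ζ from funext fun t => (hd t).deriv]
  let χ : ContDiffBump (0 : ℝ) := ⟨T + 1, T + 2, by linarith, by linarith⟩
  refine ⟨θ₀, fun t => χ t * θ₀ t, χ.contDiff.mul hsm, χ.hasCompactSupport.mul_right, ?_, hd,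
    sub_self _, fun t ht => ?_⟩
  · refine (closure_minimal (fun t ht => ?_) isClosed_Iic).trans (Iic_subset_Iio.2 haT)
    by_contra h
    exact ht (by simp [hθa t (not_le.1 h)])
  · have : χ =ᶠ[nhds t] 1 := χ.eventuallyEq_one_of_mem_ball (by
      simp only [Metric.mem_ball, dist_zero_right, Real.norm_eq_abs, χ]
      rw [abs_of_nonneg ht.1]; linarith [ht.2])
    filter_upwards [this] with s hs
    simp [hs]

/-- A continuous function whose distributional derivative on `[0,T)` is `H`, with initial value
`c`, is the primitive of `H`. -/
theorem eq_add_integral_of_weak {T : ℝ} (hT : 0 < T) {F H : ℝ → ℝ} {c : ℝ}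
    (hF : ContinuousOn F (Icc 0 T)) (hH : IntegrableOn H (Ioo 0 T))
    (h : ∀ θ : ℝ → ℝ, ContDiff ℝ (⊤ : ℕ∞) θ → HasCompactSupport θ → tsupport θ ⊆ Iio T →
      (∫ t in Ioo (0 : ℝ) T, (deriv θ t * F t + θ t * H t)) + θ 0 * c = 0) :
    ∀ t ∈ Icc 0 T, F t = c + ∫ s in (0 : ℝ)..t, H s := by
  have hHi : IntervalIntegrable H volume 0 T :=
    (intervalIntegrable_iff_integrableOn_Ioo_of_le hT.le).2 hH
  have hFi : IntervalIntegrable F volume 0 T :=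
    (hF.mono (by rw [uIcc_of_le hT.le])).intervalIntegrable
  set G : ℝ → ℝ := fun t => ∫ s in (0 : ℝ)..t, H s with hG
  have hGac : AbsolutelyContinuousOnInterval G 0 T :=
    hHi.absolutelyContinuousOnInterval_intervalIntegral (by simp)
  have hGc : ContinuousOn G (Icc 0 T) := by
    simpa [uIcc_of_le hT.le] using hGac.continuousOn
  have hGd : ∀ᵐ t, t ∈ uIoc 0 T → deriv G t = H t := by
    filter_upwards [hHi.ae_hasDerivAt_integral] with t ht htm
    exact (ht (uIoc_subset_uIcc htm) 0 (by simp)).deriv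
  have hD : ContinuousOn (fun t => F t - (c + G t)) (Icc 0 T) :=
    hF.sub (continuousOn_const.add hGc)
  have key : ∀ᵐ t, t ∈ Ioo 0 T → F t - (c + G t) = 0 := by
    refine isOpen_Ioo.ae_eq_zero_of_integral_contDiff_smul_eq_zero
      ((hD.mono Ioo_subset_Icc_self).locallyIntegrableOn measurableSet_Ioo) fun ζ hζ hζs hζT => ?_
    obtain ⟨θ₀, θ, hθ, hθs, hθT, hd, hT0, heq⟩ := exists_antideriv_test hT hζ hζs hζT
    have hθ₀c : Continuous θ₀ := continuous_iff_continuousAt.2 fun t => (hd t).continuousAt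
    have hde : deriv θ₀ = ζ := funext fun t => (hd t).deriv
    have h1 := h θ hθ hθs hθT
    rw [(heq 0 ⟨le_rfl, hT⟩).self_of_nhds] at h1
    have h2 : ∫ t in Ioo (0 : ℝ) T, (deriv θ t * F t + θ t * H t)
        = ∫ t in (0 : ℝ)..T, (ζ t * F t + θ₀ t * H t) := by
      rw [intervalIntegral.integral_of_le hT.le, integral_Ioc_eq_integral_Ioo]
      refine setIntegral_congr_fun measurableSet_Ioo fun t ht => ?_
      have := heq t ⟨ht.1.le, ht.2⟩
      simp only [this.deriv_eq, this.self_of_nhds, hde]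
    have h3 : ∫ t in (0 : ℝ)..T, θ₀ t * H t = - ∫ t in (0 : ℝ)..T, ζ t * G t := by
      have hac : AbsolutelyContinuousOnInterval θ₀ 0 T := by
        refine ContDiffOn.absolutelyContinuousOnInterval (ContDiff.contDiffOn ?_)
        refine contDiff_one_iff_deriv.2 ⟨fun t => (hd t).differentiableAt, ?_⟩
        rw [hde]; exact hζ.continuous
      have := hac.integral_mul_deriv_eq_deriv_mul hGac
      rw [hT0, hde] at this
      have hG0 : G 0 = 0 := by simp [hG]
      rw [hG0, zero_mul, mul_zero, sub_zero, zero_sub] at this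
      rw [← this]
      refine intervalIntegral.integral_congr_ae ?_
      filter_upwards [hGd] with t ht htm
      rw [ht htm]
    have h4 : ∫ t in (0 : ℝ)..T, ζ t = - θ₀ 0 := by
      rw [intervalIntegral.integral_eq_sub_of_hasDerivAt (fun t _ => hd t)
        (hζ.continuous.intervalIntegrable _ _), hT0]; ring
    have hζF : IntervalIntegrable (fun t => ζ t * F t) volume 0 T :=
      hFi.continuousOn_mul hζ.continuous.continuousOn
    have hζG : IntervalIntegrable (fun t => ζ t * G t) volume 0 T :=
      ((hGc.mono (by rw [uIcc_of_le hT.le])).intervalIntegrable).continuousOn_mul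
        hζ.continuous.continuousOn
    have hζc : IntervalIntegrable (fun t => ζ t * c) volume 0 T :=
      (hζ.continuous.mul continuous_const).intervalIntegrable _ _
    rw [h2, intervalIntegral.integral_add hζF (hHi.continuousOn_mul hθ₀c.continuousOn), h3] at h1
    have h5 : ∫ t, ζ t • (F t - (c + G t)) = ∫ t in (0 : ℝ)..T, ζ t • (F t - (c + G t)) := by
      rw [intervalIntegral.integral_of_le hT.le, setIntegral_eq_integral_of_forall_compl_eq_zero]
      intro t ht
      have : t ∉ tsupport ζ := fun h => ht (Ioo_subset_Ioc_self (hζT h))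
      simp [image_eq_zero_of_notMem_tsupport this]
    rw [h5]
    have h6 : ∀ t, ζ t • (F t - (c + G t)) = ζ t * F t - (ζ t * c + ζ t * G t) := fun t => by
      simp only [smul_eq_mul]; ring
    simp only [h6]
    rw [intervalIntegral.integral_sub hζF (hζc.add hζG), intervalIntegral.integral_add hζc hζG,
      intervalIntegral.integral_mul_const, h4]
    linarith
  have hz : ∀ t ∈ Icc 0 T, F t - (c + G t) = 0 := by
    have h1 : Set.EqOn (fun t => F t - (c + G t)) (fun _ => 0) (Ioo 0 T) :=
      Measure.eqOn_open_of_ae_eq ((ae_restrict_iff' measurableSet_Ioo).2 key)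
        isOpen_Ioo (hD.mono Ioo_subset_Icc_self) continuousOn_const
    exact h1.of_subset_closure hD continuousOn_const Ioo_subset_Icc_self
      (by rw [closure_Ioo hT.ne])
  intro t ht
  linarith [hz t ht]

theorem MemL1QT.integrable_mul {T : ℝ} {f : Euc N → ℝ → ℝ} (hf : MemL1QT T f) {k : Euc N → ℝ}
    (hk : Continuous k) {M : ℝ} (hM : ∀ x, |k x| ≤ M) : MemL1QT T (fun x t => f x t * k x) := by
  refine Integrable.mul_bdd hf (c := M) ?_ (Eventually.of_forall fun p => hM p.1)
  exact (hk.comp continuous_fst).aestronglyMeasurable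

theorem MemL1QT.ae_integrable {T : ℝ} {f : Euc N → ℝ → ℝ} (hf : MemL1QT T f) :
    ∀ᵐ t ∂(volume.restrict (Ioo 0 T)), Integrable (fun x => f x t) :=
  Integrable.prod_left_ae hf

theorem MemL1QT.integrableOn_integral {T : ℝ} {f : Euc N → ℝ → ℝ} (hf : MemL1QT T f) :
    IntegrableOn (fun t => ∫ x, f x t) (Ioo 0 T) :=
  Integrable.integral_prod_right hf

theorem MemCL1loc.locallyIntegrable {T : ℝ} {u : Euc N → ℝ → ℝ} (hu : MemCL1loc T u) {t : ℝ}
    (ht : t ∈ Icc 0 T) : LocallyIntegrable (fun x => u x t) :=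
  (locallyIntegrable_iff).2 fun K hK => (hu K hK).1 t ht

theorem MemCL1loc.integrable_mul {T : ℝ} {u : Euc N → ℝ → ℝ} (hu : MemCL1loc T u) {t : ℝ}
    (ht : t ∈ Icc 0 T) {g : Euc N → ℝ} (hg : Continuous g) (hgs : HasCompactSupport g) :
    Integrable (fun x => u x t * g x) := by
  simpa [mul_comm] using
    (hu.locallyIntegrable ht).integrable_smul_left_of_hasCompactSupport hg hgs

theorem MemCL1loc.continuousOn_integral {T : ℝ} {u : Euc N → ℝ → ℝ} (hu : MemCL1loc T u)
    {g : Euc N → ℝ} (hg : Continuous g) (hgs : HasCompactSupport g) :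
    ContinuousOn (fun t => ∫ x, u x t * g x) (Icc 0 T) := by
  intro t ht
  obtain ⟨M, hM⟩ := hgs.exists_bound_of_continuous hg
  obtain ⟨hi, hc⟩ := hu (tsupport g) hgs.isCompact
  have hc := (hc t ht).const_mul M
  rw [mul_zero] at hc
  rw [ContinuousWithinAt, tendsto_iff_norm_sub_tendsto_zero]
  refine squeeze_zero' (Eventually.of_forall fun _ => norm_nonneg _) ?_ hc
  filter_upwards [self_mem_nhdsWithin] with s hs
  rw [← integral_sub (hu.integrable_mul hs hg hgs) (hu.integrable_mul ht hg hgs),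
    ← integral_const_mul]
  have : ∫ x, (u x s * g x - u x t * g x) = ∫ x in tsupport g, (u x s * g x - u x t * g x) := by
    rw [setIntegral_eq_integral_of_forall_compl_eq_zero]
    intro x hx
    simp [image_eq_zero_of_notMem_tsupport hx]
  rw [this]
  refine norm_integral_le_of_norm_le ?_ (Eventually.of_forall fun x => ?_)
  · exact (((hi s hs).sub (hi t ht)).abs).const_mul M
  · rw [← sub_mul, norm_mul, mul_comm]
    exact mul_le_mul_of_nonneg_right (hM x) (norm_nonneg _)

/-- A distributional solution satisfies the equation tested against `g`, integrated in time. -/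
theorem IsDistSolOp.integral_mul_eq {T : ℝ} (hT : 0 < T) {μ : Measure (Euc N)}
    (hμ : IsLevyMeasure μ) {φ : ℝ → ℝ} {u0 : Euc N → ℝ} {u : Euc N → ℝ → ℝ}
    (hu1 : MemL1QT T u) (hw : MemL1QT T (fun x t => φ (u x t))) (huC : MemCL1loc T u)
    (husol : IsDistSolOp T (Lop μ) φ u0 u) {g : Euc N → ℝ} (hg : IsTestFn g) :
    ∀ t ∈ Icc 0 T, ∫ x, u x t * g x =
      (∫ x, u0 x * g x) + ∫ s in (0 : ℝ)..t, ∫ x, φ (u x s) * Lop μ g x := by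
  obtain ⟨K, -, hK⟩ := hg.exists_levyRem_bound
  obtain ⟨M, -, hM⟩ := hg.exists_bound
  have hwL := hw.integrable_mul (hg.continuous_Lop hμ) (abs_Lop_le hμ hK)
  have hug := hu1.integrable_mul hg.1.continuous hM
  refine eq_add_integral_of_weak hT (huC.continuousOn_integral hg.1.continuous hg.2)
    hwL.integrableOn_integral fun θ hθ hθs hθT => ?_
  have h1 := husol (fun x t => θ t * g x) ⟨?_, ?_, ?_⟩
  · refine Eq.trans ?_ h1
    congr 1
    · refine integral_congr_ae ?_
      filter_upwards [hwL.ae_integrable, hug.ae_integrable] with t h2 h3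
      have : ∀ x, u x t * deriv (fun s => θ s * g x) t
          + φ (u x t) * Lop μ (fun y => θ t * g y) x
          = deriv θ t * (u x t * g x) + θ t * (φ (u x t) * Lop μ g x) := by
        intro x
        rw [Lop_const_mul μ hg.differentiable, deriv_mul_const
          (hθ.differentiable (by simp) t)]
        ring
      simp only [this]
      rw [integral_add (h3.const_mul _) (h2.const_mul _), integral_const_mul, integral_const_mul]
    · rw [← integral_const_mul]
      congr 1 with x
      ring
  · exact (hθ.comp contDiff_snd).mul (hg.1.comp contDiff_fst)
  · refine HasCompactSupport.intro (hg.2.isCompact.prod hθs.isCompact) fun p hp => ?_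
    rw [mem_prod, not_and_or] at hp
    rcases hp with hp | hp <;>
      simp [Function.uncurry, image_eq_zero_of_notMem_tsupport hp]
  · refine (closure_minimal (t := {p : Euc N × ℝ | p.2 ∈ tsupport θ}) (fun p hp => ?_)
      ((isClosed_tsupport θ).preimage continuous_snd)).trans fun p hp => hθT hp
    refine subset_tsupport θ fun h => hp ?_
    simp [Function.uncurry, h]

/-- Continuous functions with compact support. -/
def IsCc (f : Euc N → ℝ) : Prop := Continuous f ∧ HasCompactSupport f

theorem IsTestFn.isCc {f : Euc N → ℝ} (hf : IsTestFn f) : IsCc f := ⟨hf.1.continuous, hf.2⟩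

theorem IsCc.integrable {f : Euc N → ℝ} (hf : IsCc f) : Integrable f :=
  hf.1.integrable_of_hasCompactSupport hf.2

theorem IsCc.mul_left {f g : Euc N → ℝ} (hf : IsCc f) (hg : Continuous g) :
    IsCc (fun x => g x * f x) := ⟨hg.mul hf.1, hf.2.mul_left⟩

theorem IsCc.add {f g : Euc N → ℝ} (hf : IsCc f) (hg : IsCc g) : IsCc (fun x => f x + g x) :=
  ⟨hf.1.add hg.1, hf.2.add hg.2⟩

theorem IsCc.const_mul {f : Euc N → ℝ} (hf : IsCc f) (c : ℝ) : IsCc (fun x => c * f x) :=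
  hf.mul_left continuous_const

theorem IsCc.exists_bound {f : Euc N → ℝ} (hf : IsCc f) : ∃ M, 0 ≤ M ∧ ∀ x, |f x| ≤ M := by
  obtain ⟨M, hM⟩ := hf.2.exists_bound_of_continuous hf.1
  exact ⟨M, (norm_nonneg _).trans (hM 0), hM⟩

theorem IsCc.integrable_mul {f g : Euc N → ℝ} (hf : IsCc f) (hg : Continuous g) :
    Integrable (fun x => g x * f x) := (hf.mul_left hg).integrable

/-- The jump operator of a finite measure. -/
def jumpOp (ν : Measure (Euc N)) (f : Euc N → ℝ) (x : Euc N) : ℝ :=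
  ∫ z, (f (x + z) - f x) ∂ν

section finite

variable {ν : Measure (Euc N)} [IsFiniteMeasure ν]

theorem IsCc.integrable_translate {f : Euc N → ℝ} (hf : IsCc f) (x : Euc N) :
    Integrable (fun z => f (x + z)) ν := by
  obtain ⟨M, -, hM⟩ := hf.exists_bound
  refine Integrable.of_bound (hf.1.comp (by fun_prop)).aestronglyMeasurable M
    (Eventually.of_forall fun z => hM _)

theorem IsCc.jumpOp_eq {f : Euc N → ℝ} (hf : IsCc f) (x : Euc N) :
    jumpOp ν f x = (∫ z, f (x + z) ∂ν) - ν.real univ * f x := by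
  rw [jumpOp, integral_sub (hf.integrable_translate x) (integrable_const _)]
  simp

theorem IsCc.abs_jumpOp_le {f : Euc N → ℝ} {M : ℝ} (hM : ∀ x, |f x| ≤ M)
    (x : Euc N) : |jumpOp ν f x| ≤ 2 * M * ν.real univ := by
  rw [← Real.norm_eq_abs]
  refine norm_integral_le_of_norm_le_const (μ := ν) (Eventually.of_forall fun z => ?_)
  exact (abs_sub _ _).trans (by linarith [hM x, hM (x + z)])

theorem IsCc.isCc_jumpOp {f : Euc N → ℝ} (hf : IsCc f) {R : ℝ} (hR : ∀ᵐ z ∂ν, ‖z‖ ≤ R) :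
    IsCc (jumpOp ν f) := by
  obtain ⟨M, -, hM⟩ := hf.exists_bound
  have hfc := hf.1
  constructor
  · refine continuous_of_dominated (bound := fun _ => 2 * M)
      (fun x => by fun_prop) (fun x => Eventually.of_forall fun z => ?_) (integrable_const _)
      (Eventually.of_forall fun z => by fun_prop)
    exact (abs_sub _ _).trans (by linarith [hM x, hM (x + z)])
  · refine HasCompactSupport.intro (hf.2.isCompact.cthickening (r := max R 0)) fun x hx => ?_
    have h : ∀ z : Euc N, ‖z‖ ≤ R → f (x + z) = 0 := fun z hz => by
      refine image_eq_zero_of_notMem_tsupport fun hz' => hx ?_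
      refine Metric.mem_cthickening_of_dist_le x (x + z) _ _ hz' ?_
      rw [dist_self_add_right]; exact hz.trans (le_max_left _ _)
    have h0 : f x = 0 := image_eq_zero_of_notMem_tsupport fun hz' => hx
      (Metric.self_subset_cthickening _ hz')
    rw [jumpOp]
    refine integral_eq_zero_of_ae ?_
    filter_upwards [hR] with z hz
    simp [h z hz, h0]

/-- The explicit Euler step is monotone under the CFL condition. -/
theorem IsCc.abs_add_mul_jumpOp_le {f : Euc N → ℝ} (hf : IsCc f) {M : ℝ} (hM : ∀ x, |f x| ≤ M)
    {a : ℝ} (ha : 0 ≤ a) (ham : a * ν.real univ ≤ 1) (x : Euc N) :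
    |f x + a * jumpOp ν f x| ≤ M := by
  rw [hf.jumpOp_eq]
  have h1 : |∫ z, f (x + z) ∂ν| ≤ M * ν.real univ :=
    norm_integral_le_of_norm_le_const (μ := ν) (f := fun z => f (x + z))
      (Eventually.of_forall fun z => hM _)
  have h2 : f x + a * ((∫ z, f (x + z) ∂ν) - ν.real univ * f x)
      = (1 - a * ν.real univ) * f x + a * ∫ z, f (x + z) ∂ν := by ring
  rw [h2]
  refine (abs_add_le _ _).trans ?_
  rw [abs_mul, abs_mul, abs_of_nonneg ha, abs_of_nonneg (sub_nonneg.2 ham)]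
  have h3 := mul_le_mul_of_nonneg_left (hM x) (sub_nonneg.2 ham)
  have h4 := mul_le_mul_of_nonneg_left h1 ha
  linarith

theorem IsCc.integrable_prod {f g : Euc N → ℝ} (hf : IsCc f) (hg : IsCc g) :
    Integrable (fun p : Euc N × Euc N => g p.1 * f (p.1 + p.2)) (volume.prod ν) := by
  obtain ⟨M, -, hM⟩ := hf.exists_bound
  have h1 := hf.1
  exact Integrable.mul_bdd (hg.integrable.comp_fst ν)
    (Continuous.aestronglyMeasurable (by fun_prop)) (Eventually.of_forall fun p => hM _)

theorem IsCc.integral_mul_translate {f g : Euc N → ℝ} (hf : IsCc f) (hg : IsCc g) :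
    ∫ x, g x * ∫ z, f (x + z) ∂ν = ∫ z, (∫ x, g x * f (x + z)) ∂ν := by
  rw [← integral_integral_swap (f := fun x z => g x * f (x + z)) (hf.integrable_prod hg)]
  simp only [integral_const_mul]

theorem IsCc.integral_mul_jumpOp_eq {f g : Euc N → ℝ} (hf : IsCc f) (hg : IsCc g) :
    ∫ x, g x * jumpOp ν f x
      = (∫ z, (∫ x, g x * f (x + z)) ∂ν) - ν.real univ * ∫ x, g x * f x := by
  rw [← hf.integral_mul_translate hg, ← integral_const_mul, ← integral_sub]
  · congr 1 with x
    rw [hf.jumpOp_eq]; ring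
  · simpa only [integral_const_mul] using (hf.integrable_prod (ν := ν) hg).integral_prod_left
  · exact (hf.mul_left hg.1).integrable.const_mul _

theorem IsCc.integral_mul_jumpOp_comm {f g : Euc N → ℝ} (hf : IsCc f) (hg : IsCc g)
    (hν : ν.map (fun z => -z) = ν) :
    ∫ x, g x * jumpOp ν f x = ∫ x, f x * jumpOp ν g x := by
  rw [hf.integral_mul_jumpOp_eq hg, hg.integral_mul_jumpOp_eq hf]
  congr 1
  · conv_lhs => rw [← hν]
    refine (integral_map_equiv (MeasurableEquiv.neg (Euc N)) fun z => ∫ x, g x * f (x + z)).trans ?_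
    congr 1 with z
    rw [← integral_add_right_eq_self (fun x => g x * f (x + MeasurableEquiv.neg (Euc N) z)) z]
    simp [mul_comm]
  · simp [mul_comm]

/-- The Dirichlet energy of the jump operator. -/
def jumpEnergy (ν : Measure (Euc N)) (f : Euc N → ℝ) : ℝ := -∫ x, f x * jumpOp ν f x

theorem IsCc.abs_integral_translate_le {f : Euc N → ℝ} (hf : IsCc f) :
    |∫ z, (∫ x, f x * f (x + z)) ∂ν| ≤ ν.real univ * ∫ x, f x ^ 2 := by
  rw [mul_comm, ← Real.norm_eq_abs]
  refine norm_integral_le_of_norm_le_const (μ := ν) (Eventually.of_forall fun z => ?_)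
  have hc := hf.1
  have hi : Integrable (fun x => f x ^ 2) := by
    simpa [sq] using hf.integrable_mul hf.1
  have hi' : Integrable (fun x => f (x + z) ^ 2) := hi.comp_add_right z
  have he : ∫ x, f (x + z) ^ 2 = ∫ x, f x ^ 2 := integral_add_right_eq_self (fun x => f x ^ 2) z
  have : ∫ x, f x ^ 2 = ∫ x, (f x ^ 2 / 2 + f (x + z) ^ 2 / 2) := by
    rw [integral_add (hi.div_const _) (hi'.div_const _), integral_div, integral_div, he]; ring
  rw [this]
  refine norm_integral_le_of_norm_le ((hi.div_const _).add (hi'.div_const _))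
    (Eventually.of_forall fun x => ?_)
  rw [Real.norm_eq_abs, abs_le]
  constructor <;> nlinarith [sq_nonneg (f x - f (x + z)), sq_nonneg (f x + f (x + z))]

theorem IsCc.jumpEnergy_nonneg {f : Euc N → ℝ} (hf : IsCc f) : 0 ≤ jumpEnergy ν f := by
  rw [jumpEnergy, hf.integral_mul_jumpOp_eq hf]
  have := (abs_le.1 (hf.abs_integral_translate_le (ν := ν))).2
  simp only [sq] at this
  linarith

theorem IsCc.jumpEnergy_le {f : Euc N → ℝ} (hf : IsCc f) :
    jumpEnergy ν f ≤ 2 * ν.real univ * ∫ x, f x ^ 2 := by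
  rw [jumpEnergy, hf.integral_mul_jumpOp_eq hf]
  have := (abs_le.1 (hf.abs_integral_translate_le (ν := ν))).1
  simp only [sq] at this ⊢
  linarith

theorem jumpOp_add_mul {f g : Euc N → ℝ} (hf : IsCc f) (hg : IsCc g) (a : ℝ) (x : Euc N) :
    jumpOp ν (fun y => f y + a * g y) x = jumpOp ν f x + a * jumpOp ν g x := by
  rw [(hf.add (hg.const_mul a)).jumpOp_eq, hf.jumpOp_eq, hg.jumpOp_eq,
    integral_add (hf.integrable_translate x) ((hg.integrable_translate x).const_mul a),
    integral_const_mul]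
  ring

/-- Energy dissipation along the explicit Euler scheme. -/
theorem IsCc.jumpEnergy_step {f c : Euc N → ℝ} (hf : IsCc f) (hc : Continuous c)
    (hν : ν.map (fun z => -z) = ν) {R : ℝ} (hR : ∀ᵐ z ∂ν, ‖z‖ ≤ R) {C h : ℝ}
    (hc0 : ∀ x, 0 ≤ c x) (hcC : ∀ x, c x ≤ C) (hh : 0 ≤ h) (hcfl : 2 * (h * C * ν.real univ) ≤ 1) :
    jumpEnergy ν (fun x => f x + h * (c x * jumpOp ν f x))
      + h * ∫ x, c x * jumpOp ν f x ^ 2 ≤ jumpEnergy ν f := by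
  have hJ : IsCc (jumpOp ν f) := hf.isCc_jumpOp hR
  have hg : IsCc (fun x => c x * jumpOp ν f x) := hJ.mul_left hc
  set g := fun x => c x * jumpOp ν f x with hgdef
  have hJg : IsCc (jumpOp ν g) := hg.isCc_jumpOp hR
  have i1 := hf.integrable_mul hJ.1
  have i2 := hf.integrable_mul hJg.1
  have i3 := hg.integrable_mul hJ.1
  have i4 := hg.integrable_mul hJg.1
  have hcomm := hf.integral_mul_jumpOp_comm hg hν
  have hexp : jumpEnergy ν (fun x => f x + h * g x) = jumpEnergy ν f
      - 2 * h * (∫ x, g x * jumpOp ν f x) + h ^ 2 * jumpEnergy ν g := by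
    unfold jumpEnergy
    have : ∀ x, (f x + h * g x) * jumpOp ν (fun y => f y + h * g y) x
        = (jumpOp ν f x * f x + h * (jumpOp ν g x * f x)) +
          (h * (jumpOp ν f x * g x) + h ^ 2 * (jumpOp ν g x * g x)) := by
      intro x
      rw [jumpOp_add_mul hf hg]; ring
    simp only [this]
    have j1 : Integrable (fun x => jumpOp ν f x * f x + h * (jumpOp ν g x * f x)) :=
      i1.add (i2.const_mul h)
    have j2 : Integrable (fun x => h * (jumpOp ν f x * g x) + h ^ 2 * (jumpOp ν g x * g x)) :=
      (i3.const_mul h).add (i4.const_mul _)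
    rw [integral_add j1 j2,
      integral_add i1 (i2.const_mul _), integral_add (i3.const_mul _) (i4.const_mul _)]
    simp only [integral_const_mul]
    simp only [mul_comm (jumpOp ν _ _)]
    rw [← hcomm]; ring
  have hgJ : ∀ x, g x * jumpOp ν f x = c x * jumpOp ν f x ^ 2 := fun x => by
    simp only [hgdef]; ring
  have hgint : Integrable (fun x => c x * jumpOp ν f x ^ 2) := by
    simpa only [mul_comm (jumpOp ν _ _), hgJ] using i3
  have hsq : ∫ x, g x ^ 2 ≤ C * ∫ x, c x * jumpOp ν f x ^ 2 := by
    rw [← integral_const_mul]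
    refine integral_mono (by simpa [sq] using hg.integrable_mul hg.1) (hgint.const_mul C)
      fun x => ?_
    have := mul_le_mul_of_nonneg_right (hcC x)
      (mul_nonneg (hc0 x) (sq_nonneg (jumpOp ν f x)))
    simp only [hgdef]
    linarith [mul_pow (c x) (jumpOp ν f x) 2, sq (c x),
      mul_assoc (c x) (c x) (jumpOp ν f x ^ 2),
      congrArg (· * jumpOp ν f x ^ 2) (sq (c x))]
  have hE := hg.jumpEnergy_le (ν := ν)
  simp only [hgJ] at hexp
  set D := ∫ x, c x * jumpOp ν f x ^ 2 with hD
  have hD0 : 0 ≤ D := integral_nonneg fun x => mul_nonneg (hc0 x) (sq_nonneg _)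
  have hm : 0 ≤ ν.real univ := measureReal_nonneg
  have h1 : jumpEnergy ν g ≤ 2 * ν.real univ * (C * D) :=
    hE.trans (mul_le_mul_of_nonneg_left hsq (by positivity))
  have h2 : h ^ 2 * jumpEnergy ν g ≤ h * D := by
    calc h ^ 2 * jumpEnergy ν g ≤ h ^ 2 * (2 * ν.real univ * (C * D)) := by gcongr
      _ = (2 * (h * C * ν.real univ)) * (h * D) := by ring
      _ ≤ 1 * (h * D) := by gcongr
      _ = h * D := one_mul _
  rw [hexp]
  linarith

end finite

/-- A Lévy measure dominates its restriction to symmetric measurable sets. -/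
theorem IsLevyMeasure.restrict {μ : Measure (Euc N)} (hμ : IsLevyMeasure μ) {A : Set (Euc N)}
    (hA : MeasurableSet A) (hAs : (fun z => -z) ⁻¹' A = A) : IsLevyMeasure (μ.restrict A) := by
  refine ⟨?_, ?_, ?_⟩
  · exact le_antisymm ((Measure.restrict_apply_le _ _).trans hμ.1.le) bot_le
  · have := Measure.restrict_map (μ := μ) (f := fun z => -z) measurable_neg hA
    rw [hμ.2.1, hAs] at this
    exact this.symm
  · exact ne_top_of_le_ne_top hμ.2.2 (lintegral_mono' Measure.restrict_le_self le_rfl)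

theorem Lop_eq_jumpOp {ν : Measure (Euc N)} [IsFiniteMeasure ν] (hν : IsLevyMeasure ν)
    {g : Euc N → ℝ} (hg : IsCc g) (x : Euc N) : Lop ν g x = jumpOp ν g x := by
  set G : Euc N → ℝ := fun z => if ‖z‖ ≤ 1 then fderiv ℝ g x z else 0 with hG
  have hGm : Measurable G := Measurable.ite
    (isClosed_le continuous_norm continuous_const).measurableSet (by fun_prop) measurable_const
  have hGi : Integrable G ν := by
    refine Integrable.of_bound hGm.aestronglyMeasurable ‖fderiv ℝ g x‖
      (Eventually.of_forall fun z => ?_)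
    simp only [hG]
    split_ifs with h
    · exact (ContinuousLinearMap.le_opNorm _ _).trans
        (mul_le_of_le_one_right (norm_nonneg _) h)
    · simp
  have hG0 : ∫ z, G z ∂ν = 0 := by
    have h1 := hν.integral_neg G
    have h2 : ∀ z, G (-z) = -G z := fun z => by
      simp only [hG, norm_neg, map_neg]; split_ifs <;> simp
    simp only [h2, MeasureTheory.integral_neg] at h1
    linarith
  have h := integral_sub ((hg.integrable_translate (ν := ν) x).sub (integrable_const (g x))) hGi
  rw [hG0, sub_zero] at h
  exact h

theorem IsLevyMeasure.exists_truncation {μ : Measure (Euc N)} (hμ : IsLevyMeasure μ) {γ : ℝ}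
    (hγ : 0 < γ) : ∃ ν : Measure (Euc N), IsLevyMeasure ν ∧ IsFiniteMeasure ν ∧
      (∃ R : ℝ, ∀ᵐ z ∂ν, ‖z‖ ≤ R) ∧ ∀ (g : Euc N → ℝ) (K : ℝ), IsCc g → 0 ≤ K →
        (∀ x z, |levyRem g x z| ≤ K * levyWeight z) → ∀ x,
          |Lop μ g x - jumpOp ν g x| ≤ K * γ ∧ |jumpOp ν g x| ≤ K * ∫ z, levyWeight z ∂μ := by
  set A : ℕ → Set (Euc N) := fun k => {z | 1 / ((k : ℝ) + 1) < ‖z‖ ∧ ‖z‖ < (k : ℝ) + 1} with hA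
  have hAm : ∀ k, MeasurableSet (A k) := fun k =>
    ((isOpen_lt continuous_const continuous_norm).inter
      (isOpen_lt continuous_norm continuous_const)).measurableSet
  have hAs : ∀ k, (fun z => -z) ⁻¹' (A k) = A k := fun k => by ext z; simp [hA]
  have hmono : Monotone A := by
    intro k l hkl z hz
    have hkl' : (k : ℝ) ≤ l := by exact_mod_cast hkl
    have h0 : (0 : ℝ) ≤ k := k.cast_nonneg
    refine ⟨lt_of_le_of_lt ?_ hz.1, hz.2.trans_le (by linarith)⟩
    gcongr
  have hInter : (⋂ k, (A k)ᶜ) = {0} := by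
    ext z
    simp only [mem_iInter, mem_compl_iff, mem_singleton_iff]
    constructor
    · intro h
      by_contra hz
      have hz' : 0 < ‖z‖ := norm_pos_iff.2 hz
      obtain ⟨k, hk⟩ := exists_nat_one_div_lt hz'
      obtain ⟨l, hl⟩ := exists_nat_gt ‖z‖
      have h1 : z ∈ A (max k l) := by
        refine ⟨lt_of_le_of_lt ?_ hk, hl.trans ?_⟩
        · gcongr; exact le_max_left _ _
        · have : (l : ℝ) ≤ (max k l : ℕ) := by exact_mod_cast le_max_right _ _
          linarith
      exact h _ h1
    · rintro rfl k hk
      have : 1 / ((k : ℝ) + 1) < 0 := by simpa using hk.1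
      exact absurd this (not_lt.2 (by positivity))
  have htail := tendsto_setIntegral_of_antitone (μ := μ) (f := levyWeight (N := N))
    (s := fun k => (A k)ᶜ) (fun k => (hAm k).compl)
    (fun k l hkl => compl_subset_compl.2 (hmono hkl)) ⟨0, hμ.integrable_levyWeight.integrableOn⟩
  rw [hInter, setIntegral_measure_zero _ hμ.1] at htail
  obtain ⟨k, hk⟩ := (htail.eventually (gt_mem_nhds hγ)).exists
  have hν := hμ.restrict (hAm k) (hAs k)
  have hfin : IsFiniteMeasure (μ.restrict (A k)) := by
    refine ⟨?_⟩
    rw [Measure.restrict_apply_univ]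
    set ε : ℝ := min ((1 / ((k : ℝ) + 1)) ^ 2) 1
    have hε : 0 < ε := lt_min (by positivity) one_pos
    refine lt_of_le_of_lt (measure_mono fun z hz => ?_)
      (hμ.integrable_levyWeight.measure_ge_lt_top hε)
    exact min_le_min_right _ (pow_le_pow_left₀ (by positivity) hz.1.le 2)
  refine ⟨_, hν, hfin, ⟨(k : ℝ) + 1, ?_⟩, fun g K hg hK0 hK x => ?_⟩
  · exact ae_restrict_of_forall_mem (hAm k) fun z hz => hz.2.le
  · rw [← Lop_eq_jumpOp hν hg]
    constructor
    · have h1 := integral_add_compl (hAm k) (integrable_levyRem hμ hg.1 hK x)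
      rw [Lop_eq_integral_levyRem, Lop_eq_integral_levyRem, ← h1, add_sub_cancel_left]
      refine (norm_integral_le_of_norm_le (f := levyRem g x)
        (hμ.integrable_levyWeight.const_mul K).integrableOn
        (Eventually.of_forall fun z => hK x z)).trans ?_
      rw [integral_const_mul]
      gcongr
    · refine (abs_Lop_le hν hK x).trans ?_
      exact mul_le_mul_of_nonneg_left (setIntegral_le_integral hμ.integrable_levyWeight
        (Eventually.of_forall levyWeight_nonneg)) hK0

/-- A smooth probability density supported in the ball of radius `ε`. -/
structure IsMollifier (ρ : Euc N → ℝ) (ε : ℝ) : Prop where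
  isTestFn : IsTestFn ρ
  nonneg : ∀ x, 0 ≤ ρ x
  integral_eq_one : ∫ x, ρ x = 1
  eq_zero : ∀ x, ε < ‖x‖ → ρ x = 0

theorem exists_isMollifier {ε : ℝ} (hε : 0 < ε) : ∃ ρ : Euc N → ℝ, IsMollifier ρ ε := by
  let b : ContDiffBump (0 : Euc N) := ⟨ε / 2, ε, by positivity, by linarith⟩
  refine ⟨b.normed volume, ⟨b.contDiff_normed, b.hasCompactSupport_normed⟩, b.nonneg_normed,
    b.integral_normed, fun x hx => ?_⟩
  refine Function.notMem_support.1 fun h => ?_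
  rw [b.support_normed_eq] at h
  have : ‖x‖ < ε := by simpa using h
  linarith

/-- Mollification. -/
def moll (ρ f : Euc N → ℝ) (x : Euc N) : ℝ := ∫ y, f y * ρ (x - y)

theorem moll_eq_convolution (ρ f : Euc N → ℝ) :
    moll ρ f = convolution f ρ (ContinuousLinearMap.mul ℝ ℝ) volume := by
  ext x; simp [moll, convolution_def]

theorem moll_eq (ρ f : Euc N → ℝ) (x : Euc N) : moll ρ f x = ∫ y, ρ y * f (x - y) := by
  rw [moll, ← integral_sub_left_eq_self (fun y => f y * ρ (x - y)) volume x]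
  simp [mul_comm]

namespace IsMollifier

variable {ρ : Euc N → ℝ} {ε : ℝ}

theorem integrable_mul (hρ : IsMollifier ρ ε) {f : Euc N → ℝ} (hf : Continuous f) (x : Euc N) :
    Integrable (fun y => ρ y * f (x - y)) := by
  simpa [mul_comm] using hρ.isTestFn.isCc.integrable_mul (g := fun y => f (x - y)) (by fun_prop)

theorem isTestFn_moll (hρ : IsMollifier ρ ε)
    {f : Euc N → ℝ} (hf : IsCc f) : IsTestFn (moll ρ f) := by
  rw [moll_eq_convolution]
  exact ⟨hρ.isTestFn.2.contDiff_convolution_right _ hf.integrable.locallyIntegrable hρ.isTestFn.1,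
    hf.2.convolution _ hρ.isTestFn.2⟩

theorem integral_moll (hρ : IsMollifier ρ ε)
    {f : Euc N → ℝ} (hf : IsCc f) : ∫ x, moll ρ f x = ∫ x, f x := by
  rw [moll_eq_convolution, integral_convolution _ hf.integrable hρ.isTestFn.isCc.integrable,
    hρ.integral_eq_one]
  simp

theorem moll_mono (hρ : IsMollifier ρ ε)
    {f g : Euc N → ℝ} (hf : Continuous f) (hg : Continuous g) (x : Euc N)
    (h : ∀ y, ‖x - y‖ ≤ ε → f y ≤ g y) : moll ρ f x ≤ moll ρ g x := by
  rw [moll_eq, moll_eq]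
  refine integral_mono (hρ.integrable_mul hf x) (hρ.integrable_mul hg x) fun y => ?_
  rcases le_or_gt ‖y‖ ε with hy | hy
  · exact mul_le_mul_of_nonneg_left (h _ (by simpa using hy)) (hρ.nonneg y)
  · simp [hρ.eq_zero y hy]

theorem moll_const (hρ : IsMollifier ρ ε) (c : ℝ) (x : Euc N) : moll ρ (fun _ => c) x = c := by
  rw [moll_eq, integral_mul_const, hρ.integral_eq_one, one_mul]

theorem moll_add_mul (hρ : IsMollifier ρ ε)
    {f g : Euc N → ℝ} (hf : Continuous f) (hg : Continuous g) (a : ℝ)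
    (x : Euc N) : moll ρ (fun y => f y + a * g y) x = moll ρ f x + a * moll ρ g x := by
  rw [moll_eq, moll_eq, moll_eq, ← integral_const_mul,
    ← integral_add (hρ.integrable_mul hf x) ((hρ.integrable_mul hg x).const_mul a)]
  congr 1 with y
  ring

theorem abs_moll_le (hρ : IsMollifier ρ ε) {f : Euc N → ℝ} (hf : Continuous f) {M : ℝ} (x : Euc N)
    (h : ∀ y, ‖x - y‖ ≤ ε → |f y| ≤ M) : |moll ρ f x| ≤ M := by
  rw [abs_le]
  constructor
  · simpa only [hρ.moll_const] using
      hρ.moll_mono continuous_const hf x fun y hy => (abs_le.1 (h y hy)).1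
  · simpa only [hρ.moll_const] using
      hρ.moll_mono hf continuous_const x fun y hy => (abs_le.1 (h y hy)).2

theorem abs_moll_sub_le (hρ : IsMollifier ρ ε)
    {f : Euc N → ℝ} (hf : Continuous f) {ω : ℝ} (x : Euc N)
    (h : ∀ y, ‖x - y‖ ≤ ε → |f y - f x| ≤ ω) : |moll ρ f x - f x| ≤ ω := by
  have h1 := hρ.moll_add_mul hf (continuous_const (y := f x)) (-1) x
  rw [hρ.moll_const] at h1
  have h2 := hρ.abs_moll_le (f := fun y => f y + -1 * f x) (by fun_prop) x
    fun y hy => by simpa [sub_eq_add_neg] using h y hy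
  rw [h1] at h2
  simpa [sub_eq_add_neg] using h2

/-- The commutator estimate used in the duality argument. -/
theorem abs_mul_moll_sub_le (hρ : IsMollifier ρ ε)
    {l c : Euc N → ℝ} (hl : Continuous l) (hc : Continuous c)
    {w v X lam : ℝ} (hlam : 0 < lam) (x : Euc N)
    (h : ∀ y, ‖x - y‖ ≤ ε → |w - v * c y| ≤ X) :
    |w * moll ρ l x - v * moll ρ (fun y => c y * l y) x|
      ≤ X ^ 2 / (2 * lam) + lam / 2 * moll ρ (fun y => l y ^ 2) x := by
  have h1 : w * moll ρ l x - v * moll ρ (fun y => c y * l y) x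
      = moll ρ (fun y => (w - v * c y) * l y) x := by
    simp only [moll_eq]
    have hcl := hρ.integrable_mul (f := fun y => c y * l y) (hc.mul hl) x
    rw [← integral_const_mul, ← integral_const_mul, ← integral_sub
      ((hρ.integrable_mul hl x).const_mul w) (hcl.const_mul v)]
    congr 1 with y
    ring
  have h2 := hρ.moll_add_mul (continuous_const (y := X ^ 2 / (2 * lam)))
    (g := fun y => l y ^ 2) (hl.pow 2) (lam / 2) x
  rw [hρ.moll_const] at h2
  rw [h1, ← h2, abs_le]
  have key : ∀ y, ‖x - y‖ ≤ ε → |(w - v * c y) * l y| ≤ X ^ 2 / (2 * lam) + lam / 2 * l y ^ 2 := by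
    intro y hy
    have hX : |w - v * c y| * |l y| ≤ X * |l y| :=
      mul_le_mul_of_nonneg_right (h y hy) (abs_nonneg _)
    rw [abs_mul, ← sq_abs (l y)]
    refine hX.trans ?_
    have h3 : X ^ 2 / (2 * lam) + lam / 2 * |l y| ^ 2 - X * |l y|
        = (X - lam * |l y|) ^ 2 / (2 * lam) := by field_simp; ring
    have h4 : 0 ≤ (X - lam * |l y|) ^ 2 / (2 * lam) := by positivity
    linarith
  constructor
  · have h5 := hρ.moll_mono (f := fun y => 0 + (-1) * (X ^ 2 / (2 * lam) + lam / 2 * l y ^ 2))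
      (g := fun y => (w - v * c y) * l y) (by fun_prop) (by fun_prop) x
      fun y hy => by have := (abs_le.1 (key y hy)).1; linarith
    rw [hρ.moll_add_mul continuous_const (by fun_prop), hρ.moll_const] at h5
    simpa using h5
  · exact hρ.moll_mono (by fun_prop) (by fun_prop) x fun y hy => (abs_le.1 (key y hy)).2

theorem jumpOp_moll (hρ : IsMollifier ρ ε)
    {ν : Measure (Euc N)} [IsFiniteMeasure ν] {f : Euc N → ℝ} (hf : IsCc f)
    (x : Euc N) : jumpOp ν (moll ρ f) x = moll ρ (jumpOp ν f) x := by
  have hc := hf.1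
  have hρc := hρ.isTestFn.1.continuous
  obtain ⟨M, -, hM⟩ := hf.exists_bound
  have hgint : Integrable (fun p : Euc N × Euc N => ρ p.1 * (f (x - p.1 + p.2) - f (x - p.1)))
      (volume.prod ν) := by
    refine Integrable.mul_bdd (c := 2 * M) (hρ.isTestFn.isCc.integrable.comp_fst ν)
      (Continuous.aestronglyMeasurable (by fun_prop)) (Eventually.of_forall fun p => ?_)
    exact (abs_sub _ _).trans (by linarith [hM (x - p.1), hM (x - p.1 + p.2)])
  rw [moll_eq]
  simp only [jumpOp]
  simp only [← integral_const_mul]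
  rw [integral_integral_swap (f := fun y z => ρ y * (f (x - y + z) - f (x - y))) hgint]
  congr 1 with z
  rw [moll_eq, moll_eq, ← integral_sub (hρ.integrable_mul hf.1 _) (hρ.integrable_mul hf.1 _)]
  congr 1 with y
  rw [sub_add_eq_add_sub, mul_sub]

theorem fderiv_moll (hρ : IsMollifier ρ ε) {f : Euc N → ℝ} (hf : IsCc f) (x z : Euc N) :
    fderiv ℝ (moll ρ f) x z = ∫ y, f y * fderiv ℝ ρ (x - y) z := by
  have hs : ContDiff ℝ 1 ρ := hρ.isTestFn.1.of_le (by norm_cast)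
  rw [moll_eq_convolution, (hρ.isTestFn.2.hasFDerivAt_convolution_right
    (ContinuousLinearMap.mul ℝ ℝ) hf.integrable.locallyIntegrable hs x).fderiv,
    convolution_precompR_apply _ hf.integrable.locallyIntegrable (hρ.isTestFn.2.fderiv ℝ)
      (hs.continuous_fderiv one_ne_zero)]
  simp [convolution_def]

/-- Mollification turns sup bounds into bounds on the Lévy remainder. -/
theorem exists_levyRem_moll_bound (hρ : IsMollifier ρ ε)
    : ∃ C, 0 ≤ C ∧ ∀ f : Euc N → ℝ, IsCc f → ∀ M, 0 ≤ M →
    (∀ x, |f x| ≤ M) → ∀ x z, |levyRem (moll ρ f) x z| ≤ C * M * levyWeight z := by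
  obtain ⟨C, hC0, hC⟩ := hρ.isTestFn.exists_fderiv_lipschitz
  set V : ℝ := volume.real (Metric.closedBall (0 : Euc N) (ε + 1)) with hV
  have hρc := hρ.isTestFn.1.continuous
  have hρd : Continuous (fderiv ℝ ρ) := hρ.isTestFn.1.continuous_fderiv (by simp)
  refine ⟨max (C * V) 2, le_max_of_le_right zero_le_two, fun f hf M hM0 hM x z => ?_⟩
  rw [max_mul_of_nonneg _ _ hM0]
  refine abs_levyRem_le (fun hz => ?_) (fun _ => ?_)
  · have hi : ∀ a, Integrable (fun y => f y * ρ (a - y)) := fun a => by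
      simpa [mul_comm] using hf.integrable_mul (g := fun y => ρ (a - y)) (by fun_prop)
    have hi' : Integrable (fun y => f y * fderiv ℝ ρ (x - y) z) := by
      simpa [mul_comm] using hf.integrable_mul (g := fun y => fderiv ℝ ρ (x - y) z) (by fun_prop)
    have e : moll ρ f (x + z) - moll ρ f x - fderiv ℝ (moll ρ f) x z
        = ∫ y, (f y * ρ (x + z - y) - f y * ρ (x - y) - f y * fderiv ℝ ρ (x - y) z) := by
      have hi2 : Integrable (fun y => f y * ρ (x + z - y) - f y * ρ (x - y)) :=
        (hi (x + z)).sub (hi x)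
      rw [hρ.fderiv_moll hf, integral_sub hi2 hi',
        integral_sub (hi _) (hi _), moll, moll]
    have hVx : volume.real (Metric.closedBall x (ε + 1)) = V := by
      simp only [hV, measureReal_def, Measure.addHaar_closedBall_center volume x]
    have hb : Integrable ((Metric.closedBall x (ε + 1)).indicator
        fun _ : Euc N => M * (C * ‖z‖ ^ 2)) :=
      (integrable_indicator_iff measurableSet_closedBall).2
        (integrableOn_const (measure_closedBall_lt_top).ne)
    have hval : C * V * M * ‖z‖ ^ 2 = ∫ y, (Metric.closedBall x (ε + 1)).indicator
        (fun _ : Euc N => M * (C * ‖z‖ ^ 2)) y := by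
      rw [integral_indicator measurableSet_closedBall, setIntegral_const, hVx, smul_eq_mul]
      ring
    rw [e, hval, ← Real.norm_eq_abs]
    refine norm_integral_le_of_norm_le hb (Eventually.of_forall fun y => ?_)
    rw [← mul_sub, ← mul_sub, norm_mul]
    by_cases hy : y ∈ Metric.closedBall x (ε + 1)
    · rw [indicator_of_mem hy]
      have := abs_taylor_le hρ.isTestFn.differentiable hC (x - y) z
      rw [sub_add_eq_add_sub] at this
      exact mul_le_mul (hM y) this (norm_nonneg _) hM0
    · rw [indicator_of_notMem hy]
      have hy' : ε + 1 < ‖x - y‖ := by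
        rw [Metric.mem_closedBall, dist_comm, dist_eq_norm] at hy; exact not_le.1 hy
      have h1 : ρ (x - y) = 0 := hρ.eq_zero _ (by linarith)
      have h2 : ρ (x + z - y) = 0 := hρ.eq_zero _ (by
        have := norm_sub_norm_le (x - y) (-z)
        rw [norm_neg, sub_neg_eq_add, sub_add_eq_add_sub] at this
        linarith)
      have h3 : fderiv ℝ ρ (x - y) = 0 := by
        have : ρ =ᶠ[nhds (x - y)] fun _ => 0 := by
          filter_upwards [(isOpen_lt (continuous_const (y := ε)) continuous_norm).mem_nhds
            (show ε < ‖x - y‖ by linarith)] with a ha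
          exact hρ.eq_zero a ha
        rw [this.fderiv_eq]; simp
      simp [h1, h2, h3]
  · have h1 := hρ.abs_moll_le hf.1 (x + z) fun y _ => hM y
    have h2 := hρ.abs_moll_le hf.1 x fun y _ => hM y
    exact (abs_sub _ _).trans (by linarith)

end IsMollifier

/-- The quotient of two functions is approximated, in a weighted `L²` space, by nonnegative
continuous functions with compact support. -/
theorem exists_coeff_approx {P : Measure (Euc N × ℝ)} {u w : Euc N × ℝ → ℝ}
    (hu : AEStronglyMeasurable u P) (hu2 : Integrable (fun p => u p ^ 2) P)
    (hw : AEStronglyMeasurable w P) {C : ℝ} (hC0 : 0 ≤ C)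
    (hwu : ∀ᵐ p ∂P, 0 ≤ w p * u p ∧ |w p| ≤ C * |u p|) {κ : ℝ} (hκ : 0 < κ) :
    ∃ b : Euc N × ℝ → ℝ, Continuous b ∧ HasCompactSupport b ∧ (∀ p, 0 ≤ b p) ∧
      Integrable (fun p => (w p - b p * u p) ^ 2) P ∧ ∫ p, (w p - b p * u p) ^ 2 ∂P ≤ κ := by
  set a : Euc N × ℝ → ℝ := fun p => w p / u p with ha
  have ham : AEStronglyMeasurable a P :=
    (hw.aemeasurable.div hu.aemeasurable).aestronglyMeasurable
  have hab : ∀ᵐ p ∂P, 0 ≤ a p ∧ a p ≤ C ∧ w p = a p * u p := by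
    filter_upwards [hwu] with p ⟨h1, h2⟩
    rcases eq_or_ne (u p) 0 with h | h
    · have : w p = 0 := by simpa [h] using h2
      simp [ha, h, this, hC0]
    · have h3 : 0 ≤ a p := by
        simp only [ha]
        rw [show w p / u p = w p * u p / u p ^ 2 by field_simp]
        positivity
      refine ⟨h3, ?_, by simp [ha, h]⟩
      rw [← abs_of_nonneg h3, abs_div, div_le_iff₀ (abs_pos.2 h)]
      exact h2
  set d : Euc N × ℝ → ENNReal := fun p => ENNReal.ofReal (u p ^ 2) with hd
  have hdm : AEMeasurable d P := (hu2.aemeasurable).ennreal_ofReal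
  set m := P.withDensity d with hm
  have hmf : IsFiniteMeasure m := isFiniteMeasure_withDensity_ofReal hu2.2
  have hac : m ≪ P := withDensity_absolutelyContinuous _ _
  have hgint : ∀ g : Euc N × ℝ → ℝ, ∫ p, g p ∂m = ∫ p, u p ^ 2 * g p ∂P := fun g => by
    rw [hm, integral_withDensity_eq_integral_toReal_smul₀ hdm
      (Eventually.of_forall fun p => ENNReal.ofReal_lt_top)]
    simp [hd, ENNReal.toReal_ofReal, sq_nonneg]
  have habm : ∀ᵐ p ∂m, 0 ≤ a p ∧ a p ≤ C ∧ w p = a p * u p := hac hab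
  have haL : MemLp a (ENNReal.ofReal 2) m := by
    refine MemLp.of_bound (ham.mono_ac hac) C ?_
    filter_upwards [habm] with p hp
    rw [Real.norm_eq_abs, abs_of_nonneg hp.1]; exact hp.2.1
  obtain ⟨f, hfs, hfle, hfc, hfL⟩ :=
    haL.exists_hasCompactSupport_integral_rpow_sub_le (by norm_num) hκ
  have hbc : Continuous fun p => max (f p) 0 := hfc.max continuous_const
  have hbs : HasCompactSupport fun p => max (f p) 0 :=
    hfs.comp_left (g := fun r => max r 0) (by simp)
  obtain ⟨B, hB⟩ := hbs.exists_bound_of_continuous hbc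
  refine ⟨_, hbc, hbs, fun p => le_max_right _ _, ?_, ?_⟩
  · refine (hu2.const_mul ((C + B) ^ 2)).mono'
      ((hw.sub (hbc.aestronglyMeasurable.mul hu)).pow 2) ?_
    filter_upwards [hwu] with p ⟨_, h2⟩
    have h3 : |w p - max (f p) 0 * u p| ≤ (C + B) * |u p| := by
      refine (abs_sub _ _).trans ?_
      rw [abs_mul, add_mul]
      exact add_le_add h2 (mul_le_mul_of_nonneg_right (hB p) (abs_nonneg _))
    rw [Real.norm_eq_abs, abs_pow]
    calc |w p - max (f p) 0 * u p| ^ 2 ≤ ((C + B) * |u p|) ^ 2 := by gcongr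
      _ = (C + B) ^ 2 * u p ^ 2 := by rw [mul_pow, sq_abs]
  · refine le_trans ?_ hfle
    have h1 : ∫ p, (w p - max (f p) 0 * u p) ^ 2 ∂P = ∫ p, (a p - max (f p) 0) ^ 2 ∂m := by
      rw [hgint]
      refine integral_congr_ae ?_
      filter_upwards [hab] with p hp
      conv_lhs => rw [hp.2.2]
      ring
    rw [h1]
    refine integral_mono_of_nonneg (Eventually.of_forall fun p => sq_nonneg _) ?_ ?_
    · have := (haL.sub hfL).integrable_norm_rpow (by simp) (by simp)
      simpa using this
    · filter_upwards [habm] with p hp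
      have h2 : |a p - max (f p) 0| ≤ |a p - f p| := by
        have := abs_max_sub_max_le_abs (a p) (f p) 0
        rwa [max_eq_left hp.1] at this
      rw [← sq_abs]
      simp only [Real.norm_eq_abs, Real.rpow_ofNat]
      gcongr

theorem IsCc.sq {f : Euc N → ℝ} (hf : IsCc f) : IsCc (fun x => f x ^ 2) := by
  simpa only [pow_two] using hf.mul_left hf.1

/-- The duality defect at a fixed time. -/
theorem IsMollifier.slice_estimate {ρ : Euc N → ℝ} {ε : ℝ} (hρ : IsMollifier ρ ε)
    {A : Euc N → ℝ} {ν : Measure (Euc N)} [IsFiniteMeasure ν]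
    {e c : Euc N → ℝ} (he : IsCc e) (hl : IsCc (jumpOp ν e)) (hc : Continuous c) {γ κ lam : ℝ}
    (hlam : 0 < lam) (hA : ∀ x, |A x - jumpOp ν (moll ρ e) x| ≤ γ)
    {w v β : Euc N → ℝ} (hw : Integrable w)
    (hY : Integrable fun x => 2 * (w x - β x * v x) ^ 2 + 8 * κ ^ 2 * v x ^ 2)
    (hv : Integrable fun x => v x * moll ρ (fun y => c y * jumpOp ν e y) x)
    (hβ : ∀ x y, ‖x - y‖ ≤ ε → |β x - c y| ≤ 2 * κ) (hwA : Integrable fun x => w x * A x) :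
    (∫ x, w x * A x) - ∫ x, v x * moll ρ (fun y => c y * jumpOp ν e y) x
      ≤ γ * (∫ x, |w x|) +
        1 / (2 * lam) * (∫ x, (2 * (w x - β x * v x) ^ 2 + 8 * κ ^ 2 * v x ^ 2))
        + lam / 2 * ∫ x, jumpOp ν e x ^ 2 := by
  have hm : Integrable (moll ρ fun y => jumpOp ν e y ^ 2) :=
    (hρ.isTestFn_moll hl.sq).isCc.integrable
  rw [← hρ.integral_moll hl.sq, ← integral_sub hwA hv, ← integral_const_mul, ← integral_const_mul,
    ← integral_const_mul]
  have i1 := hw.abs.const_mul γ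
  have i2 := hY.const_mul (1 / (2 * lam))
  have i3 : Integrable fun x => γ * |w x| +
      1 / (2 * lam) * (2 * (w x - β x * v x) ^ 2 + 8 * κ ^ 2 * v x ^ 2) := i1.add i2
  rw [← integral_add i1 i2, ← integral_add i3 (hm.const_mul (lam / 2))]
  refine integral_mono (hwA.sub hv) (i3.add (hm.const_mul (lam / 2))) fun x => ?_
  have hX : ∀ y, ‖x - y‖ ≤ ε → |w x - v x * c y| ≤ |w x - β x * v x| + 2 * κ * |v x| := by
    intro y hy
    have e1 : w x - v x * c y = (w x - β x * v x) + (β x - c y) * v x := by ring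
    rw [e1]
    refine (abs_add_le _ _).trans ?_
    rw [abs_mul (β x - c y)]
    gcongr
    exact hβ x y hy
  have h1 := hρ.abs_mul_moll_sub_le hl.1 hc hlam x hX
  have h2 : |w x * (A x - jumpOp ν (moll ρ e) x)| ≤ γ * |w x| := by
    rw [abs_mul, mul_comm]
    exact mul_le_mul_of_nonneg_right (hA x) (abs_nonneg _)
  rw [hρ.jumpOp_moll he] at h2
  have h3 : (|w x - β x * v x| + 2 * κ * |v x|) ^ 2 / (2 * lam)
      ≤ 1 / (2 * lam) * (2 * (w x - β x * v x) ^ 2 + 8 * κ ^ 2 * v x ^ 2) := by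
    rw [div_eq_inv_mul, ← one_div]
    refine mul_le_mul_of_nonneg_left ?_ (by positivity)
    rw [← sq_abs (w x - β x * v x), ← sq_abs (v x)]
    nlinarith [sq_nonneg (|w x - β x * v x| - 2 * κ * |v x|)]
  have h4 := (abs_le.1 h1).2
  have h5 := (abs_le.1 h2).2
  dsimp only
  linarith

theorem MemL1QT.intervalIntegrable {T : ℝ} (hT : 0 < T) {f : Euc N → ℝ → ℝ} (hf : MemL1QT T f)
    {a b : ℝ} (ha : a ∈ Icc 0 T) (hb : b ∈ Icc 0 T) :
    IntervalIntegrable (fun t => ∫ x, f x t) volume a b := by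
  have h := (intervalIntegrable_iff_integrableOn_Ioo_of_le hT.le).2 hf.integrableOn_integral
  refine h.mono_set ?_
  rw [uIcc_of_le hT.le]
  exact (convex_Icc 0 T).ordConnected.uIcc_subset ha hb

theorem ae_Icc_of_ae_Ioo {T a b : ℝ} (ha : a ∈ Icc 0 T) (hb : b ∈ Icc 0 T) {p : ℝ → Prop}
    (h : ∀ᵐ t ∂(volume.restrict (Ioo 0 T)), p t) : ∀ᵐ t ∂(volume.restrict (Icc a b)), p t := by
  rw [Measure.restrict_congr_set Ioo_ae_eq_Icc] at h
  exact ae_restrict_of_ae_restrict_of_subset (Icc_subset_Icc ha.1 hb.2) h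

theorem IsDistSolOp.integral_mul_sub {T : ℝ} (hT : 0 < T) {μ : Measure (Euc N)}
    (hμ : IsLevyMeasure μ) {φ : ℝ → ℝ} {u0 : Euc N → ℝ} {u : Euc N → ℝ → ℝ}
    (hu1 : MemL1QT T u) (hw : MemL1QT T (fun x t => φ (u x t))) (huC : MemCL1loc T u)
    (husol : IsDistSolOp T (Lop μ) φ u0 u) {g : Euc N → ℝ} (hg : IsTestFn g) {a b : ℝ}
    (ha : a ∈ Icc 0 T) (hb : b ∈ Icc 0 T) :
    (∫ x, u x b * g x) - ∫ x, u x a * g x = ∫ s in a..b, ∫ x, φ (u x s) * Lop μ g x := by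
  obtain ⟨K, -, hK⟩ := hg.exists_levyRem_bound
  have hwL := hw.integrable_mul (hg.continuous_Lop hμ) (abs_Lop_le hμ hK)
  have h0 : (0 : ℝ) ∈ Icc 0 T := left_mem_Icc.2 hT.le
  rw [husol.integral_mul_eq hT hμ hu1 hw huC hg b hb, husol.integral_mul_eq hT hμ hu1 hw huC hg a ha,
    ← intervalIntegral.integral_add_adjacent_intervals (hwL.intervalIntegrable hT h0 ha)
      (hwL.intervalIntegrable hT ha hb)]
  ring

/-- One backward Euler step of the dual problem. -/
theorem IsDistSolOp.duality_step {T : ℝ} (hT : 0 < T) {μ : Measure (Euc N)}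
    (hμ : IsLevyMeasure μ) {φ : ℝ → ℝ} {u0 : Euc N → ℝ} {u : Euc N → ℝ → ℝ}
    (hu1 : MemL1QT T u) (hw : MemL1QT T (fun x t => φ (u x t))) (huC : MemCL1loc T u)
    (husol : IsDistSolOp T (Lop μ) φ u0 u)
    {ν : Measure (Euc N)} [IsFiniteMeasure ν] (hν : IsLevyMeasure ν) {R : ℝ}
    (hR : ∀ᵐ z ∂ν, ‖z‖ ≤ R) {γ : ℝ}
    (htr : ∀ (g : Euc N → ℝ) (K : ℝ), IsCc g → 0 ≤ K →
      (∀ x z, |levyRem g x z| ≤ K * levyWeight z) → ∀ x,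
          |Lop μ g x - jumpOp ν g x| ≤ K * γ ∧ |jumpOp ν g x| ≤ K * ∫ z, levyWeight z ∂μ)
    {ρ : Euc N → ℝ} {ε : ℝ} (hρ : IsMollifier ρ ε) {D : ℝ} (hD0 : 0 ≤ D)
    (hD : ∀ f : Euc N → ℝ, IsCc f → ∀ M, 0 ≤ M →
      (∀ x, |f x| ≤ M) → ∀ x z, |levyRem (moll ρ f) x z| ≤ D * M * levyWeight z)
    {b : Euc N × ℝ → ℝ} (hb : Continuous b) (hb0 : ∀ p, 0 ≤ b p) {κ C : ℝ} (hκ : 0 < κ)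
    (hbC : ∀ p, b p + κ ≤ C)
    (hY : MemL1QT T fun x t =>
      2 * (φ (u x t) - b (x, t) * u x t) ^ 2 + 8 * κ ^ 2 * u x t ^ 2)
    {lam : ℝ} (hlam : 0 < lam) {t0 t1 : ℝ} (ht0 : t0 ∈ Icc 0 T) (ht1 : t1 ∈ Icc 0 T)
    (h01 : t0 ≤ t1)
    (hosc : ∀ x y s, s ∈ Icc t0 t1 → ‖x - y‖ ≤ ε → |b (x, s) - b (y, t0)| ≤ κ)
    (hcfl : 2 * ((t1 - t0) * C * ν.real univ) ≤ 1) {γ' : ℝ}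
    (hγ' : D * γ + (t1 - t0) * (D * (C * (2 * ν.real univ)) * ∫ z, levyWeight z ∂μ) ≤ γ')
    {e : Euc N → ℝ} (he : IsCc e) (he1 : ∀ x, |e x| ≤ 1) :
    ∃ e' : Euc N → ℝ, IsCc e' ∧ (∀ x, |e' x| ≤ 1) ∧
      (∫ x, u x t1 * moll ρ e x) + lam / (2 * κ) * jumpEnergy ν e' ≤
        (∫ x, u x t0 * moll ρ e' x) + (∫ s in t0..t1, (γ' * (∫ x, |φ (u x s)|) + 1 / (2 * lam) *
          ∫ x, (2 * (φ (u x s) - b (x, s) * u x s) ^ 2 + 8 * κ ^ 2 * u x s ^ 2)))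
        + lam / (2 * κ) * jumpEnergy ν e := by
  set h := t1 - t0 with hh
  have hh0 : 0 ≤ h := sub_nonneg.2 h01
  have hm0 : 0 ≤ ν.real univ := measureReal_nonneg
  set m := ν.real univ with hm
  set Λ := ∫ z, levyWeight z ∂μ with hΛ
  have hΛ0 : 0 ≤ Λ := integral_nonneg levyWeight_nonneg
  set l := jumpOp ν e with hl_def
  have hl : IsCc l := he.isCc_jumpOp hR
  set c : Euc N → ℝ := fun x => b (x, t0) + κ with hc_def
  have hc : Continuous c := by fun_prop
  have hc0 : ∀ x, κ ≤ c x := fun x => by simp only [hc_def]; linarith [hb0 (x, t0)]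
  have hcC : ∀ x, c x ≤ C := fun x => hbC _
  have hC0 : 0 ≤ C := hκ.le.trans ((hc0 0).trans (hcC 0))
  have hcl : IsCc fun x => c x * l x := hl.mul_left hc
  set g := moll ρ e with hg_def
  set d := moll ρ (fun x => c x * l x) with hd_def
  have hg : IsTestFn g := hρ.isTestFn_moll he
  have hd : IsTestFn d := hρ.isTestFn_moll hcl
  have hlb : ∀ x, |l x| ≤ 2 * m := fun x => by
    simpa using IsCc.abs_jumpOp_le (ν := ν) he1 x
  have hclb : ∀ x, |c x * l x| ≤ C * (2 * m) := fun x => by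
    rw [abs_mul, abs_of_nonneg (hκ.le.trans (hc0 x))]
    exact mul_le_mul (hcC x) (hlb x) (abs_nonneg _) hC0
  have hgK := hD e he 1 zero_le_one he1
  have hdK := hD _ hcl _ (by positivity) hclb
  set Kd := D * (C * (2 * m)) with hKd
  have hLg := abs_Lop_le hμ hgK
  have hLd := abs_Lop_le hμ hdK
  have hwg := hw.integrable_mul (hg.continuous_Lop hμ) hLg
  have hwd := hw.integrable_mul (hd.continuous_Lop hμ) hLd
  have hwabs : MemL1QT T fun x t => |φ (u x t)| := Integrable.abs hw
  have IW := hwabs.intervalIntegrable hT ht0 ht1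
  have IY := hY.intervalIntegrable hT ht0 ht1
  have Ig := hwg.intervalIntegrable hT ht0 ht1
  set W : ℝ → ℝ := fun s => ∫ x, |φ (u x s)| with hW
  set Y : ℝ → ℝ := fun s => ∫ x, (2 * (φ (u x s) - b (x, s) * u x s) ^ 2 + 8 * κ ^ 2 * u x s ^ 2)
    with hYdef
  set J := ∫ x, l x ^ 2 with hJ
  set ω := ∫ s in t0..t1, W s with hω
  have hHd : ∀ᵐ s ∂(volume.restrict (Icc t0 t1)),
      |∫ x, φ (u x s) * Lop μ d x| ≤ Kd * Λ * W s := by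
    filter_upwards [ae_Icc_of_ae_Ioo ht0 ht1 hw.ae_integrable] with s hs
    rw [← integral_const_mul, ← Real.norm_eq_abs]
    refine norm_integral_le_of_norm_le (hs.abs.const_mul _) (Eventually.of_forall fun x => ?_)
    rw [Real.norm_eq_abs, abs_mul, mul_comm]
    exact mul_le_mul_of_nonneg_right (hLd x) (abs_nonneg _)
  have hW0 : ∀ s, 0 ≤ W s := fun s => integral_nonneg fun x => abs_nonneg _
  have hosc_d : ∀ s ∈ Icc t0 t1, (∫ x, u x s * d x) - (∫ x, u x t0 * d x) ≤ Kd * Λ * ω := by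
    intro s hs
    have hsT : s ∈ Icc 0 T := ⟨ht0.1.trans hs.1, hs.2.trans ht1.2⟩
    rw [husol.integral_mul_sub hT hμ hu1 hw huC hd ht0 hsT]
    have i1 := (hwabs.intervalIntegrable hT ht0 hsT).const_mul (Kd * Λ)
    calc (∫ s in t0..s, ∫ x, φ (u x s) * Lop μ d x)
        ≤ ∫ s in t0..s, Kd * Λ * W s := by
          refine intervalIntegral.integral_mono_ae_restrict hs.1
            (hwd.intervalIntegrable hT ht0 hsT) i1 ?_
          filter_upwards [ae_restrict_of_ae_restrict_of_subset
            (Icc_subset_Icc le_rfl hs.2) hHd] with r hr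
          exact (le_abs_self _).trans hr
      _ ≤ ∫ s in t0..t1, Kd * Λ * W s := by
          refine intervalIntegral.integral_mono_interval le_rfl hs.1 hs.2
            (Eventually.of_forall fun r => ?_) (IW.const_mul _)
          have := hW0 r
          simp only [Pi.zero_apply]
          positivity
      _ = Kd * Λ * ω := by rw [intervalIntegral.integral_const_mul]
  have hslice : ∀ᵐ s ∂(volume.restrict (Icc t0 t1)), (∫ x, φ (u x s) * Lop μ g x)
      ≤ (∫ x, u x t0 * d x) + (Kd * Λ * ω + lam / 2 * J)
        + (D * γ * W s + 1 / (2 * lam) * Y s) := by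
    filter_upwards [ae_Icc_of_ae_Ioo ht0 ht1 hw.ae_integrable,
      ae_Icc_of_ae_Ioo ht0 ht1 hY.ae_integrable, ae_Icc_of_ae_Ioo ht0 ht1 hwg.ae_integrable,
      ae_restrict_mem measurableSet_Icc] with s h1 h2 h3 hs
    have hsT : s ∈ Icc 0 T := ⟨ht0.1.trans hs.1, hs.2.trans ht1.2⟩
    have h4 := hρ.slice_estimate (A := Lop μ g) (γ := D * γ) he hl hc hlam
      (fun x => by simpa using (htr g (D * 1) hg.isCc (by positivity) hgK x).1) h1 h2
      (huC.integrable_mul hsT hd.1.continuous hd.2)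
      (fun x y hxy => by
        have h5 := hosc x y s hs hxy
        have h6 : b (x, s) - c y = (b (x, s) - b (y, t0)) - κ := by simp only [hc_def]; ring
        rw [h6]
        refine (abs_sub _ _).trans ?_
        rw [abs_of_pos hκ]
        linarith) h3
    have h7 := hosc_d s hs
    linarith
  have hmain : (∫ x, u x t1 * g x) - (∫ x, u x t0 * g x)
      ≤ h * ((∫ x, u x t0 * d x) + (Kd * Λ * ω + lam / 2 * J))
        + (D * γ * ω + 1 / (2 * lam) * ∫ s in t0..t1, Y s) := by
    rw [husol.integral_mul_sub hT hμ hu1 hw huC hg ht0 ht1]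
    have IZ := (IW.const_mul (D * γ)).add (IY.const_mul (1 / (2 * lam)))
    refine (intervalIntegral.integral_mono_ae_restrict h01 Ig
      (intervalIntegrable_const.add IZ) hslice).trans (le_of_eq ?_)
    rw [intervalIntegral.integral_add intervalIntegrable_const IZ,
      intervalIntegral.integral_add (IW.const_mul (D * γ)) (IY.const_mul (1 / (2 * lam))),
      intervalIntegral.integral_const, intervalIntegral.integral_const_mul,
      intervalIntegral.integral_const_mul, smul_eq_mul]
  have henergy := he.jumpEnergy_step hc hν.2.1 hR (fun x => hκ.le.trans (hc0 x)) hcC hh0 hcfl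
  have hJle : κ * J ≤ ∫ x, c x * l x ^ 2 := by
    rw [hJ, ← integral_const_mul]
    refine integral_mono (hl.sq.integrable.const_mul κ) (hl.sq.mul_left hc).integrable fun x => ?_
    exact mul_le_mul_of_nonneg_right (hc0 x) (sq_nonneg _)
  refine ⟨fun x => e x + h * (c x * l x), he.add (hcl.const_mul h), fun x => ?_, ?_⟩
  · beta_reduce
    rw [← mul_assoc]
    refine he.abs_add_mul_jumpOp_le he1 (mul_nonneg hh0 (hκ.le.trans (hc0 x))) ?_ x
    have : h * c x * m ≤ h * C * m := by gcongr; exact hcC x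
    linarith
  · have hsplit : (∫ x, u x t0 * moll ρ (fun x => e x + h * (c x * l x)) x)
        = (∫ x, u x t0 * g x) + h * ∫ x, u x t0 * d x := by
      rw [← integral_const_mul, ← integral_add (huC.integrable_mul ht0 hg.1.continuous hg.2)
        ((huC.integrable_mul ht0 hd.1.continuous hd.2).const_mul h)]
      congr 1 with x
      rw [hρ.moll_add_mul he.1 hcl.1]; ring
    have hZ : (∫ s in t0..t1, (γ' * W s + 1 / (2 * lam) * Y s))
        = γ' * ω + 1 / (2 * lam) * ∫ s in t0..t1, Y s := by
      rw [intervalIntegral.integral_add (IW.const_mul _) (IY.const_mul _),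
        intervalIntegral.integral_const_mul, intervalIntegral.integral_const_mul]
    have hω0 : 0 ≤ ω := intervalIntegral.integral_nonneg h01 fun s _ => hW0 s
    have h8 := mul_le_mul_of_nonneg_right hγ' hω0
    have h9 : lam / (2 * κ) * (h * (κ * J)) = h * (lam / 2 * J) := by field_simp
    have h10 : lam / (2 * κ) * (jumpEnergy ν (fun x => e x + h * (c x * l x)) + h * (κ * J))
        ≤ lam / (2 * κ) * jumpEnergy ν e := by
      refine mul_le_mul_of_nonneg_left ?_ (by positivity)
      have := mul_le_mul_of_nonneg_left hJle hh0
      linarith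
    rw [hsplit, hZ]
    linarith

/-- Iterating the backward Euler step down to the initial time. -/
theorem IsDistSolOp.duality_iter {T : ℝ} (hT : 0 < T) {μ : Measure (Euc N)}
    (hμ : IsLevyMeasure μ) {φ : ℝ → ℝ} {u0 : Euc N → ℝ} {u : Euc N → ℝ → ℝ}
    (hu1 : MemL1QT T u) (hw : MemL1QT T (fun x t => φ (u x t))) (huC : MemCL1loc T u)
    (husol : IsDistSolOp T (Lop μ) φ u0 u)
    {ν : Measure (Euc N)} [IsFiniteMeasure ν] (hν : IsLevyMeasure ν) {R : ℝ}
    (hR : ∀ᵐ z ∂ν, ‖z‖ ≤ R) {γ : ℝ}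
    (htr : ∀ (g : Euc N → ℝ) (K : ℝ), IsCc g → 0 ≤ K →
      (∀ x z, |levyRem g x z| ≤ K * levyWeight z) → ∀ x,
          |Lop μ g x - jumpOp ν g x| ≤ K * γ ∧ |jumpOp ν g x| ≤ K * ∫ z, levyWeight z ∂μ)
    {ρ : Euc N → ℝ} {ε : ℝ} (hρ : IsMollifier ρ ε) {D : ℝ} (hD0 : 0 ≤ D)
    (hD : ∀ f : Euc N → ℝ, IsCc f → ∀ M, 0 ≤ M →
      (∀ x, |f x| ≤ M) → ∀ x z, |levyRem (moll ρ f) x z| ≤ D * M * levyWeight z)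
    {b : Euc N × ℝ → ℝ} (hb : Continuous b) (hb0 : ∀ p, 0 ≤ b p) {κ C : ℝ} (hκ : 0 < κ)
    (hbC : ∀ p, b p + κ ≤ C)
    (hY : MemL1QT T fun x t =>
      2 * (φ (u x t) - b (x, t) * u x t) ^ 2 + 8 * κ ^ 2 * u x t ^ 2)
    {lam : ℝ} (hlam : 0 < lam) {h : ℝ} (hh : 0 ≤ h)
    (hosc : ∀ x y s s', |s - s'| ≤ h → ‖x - y‖ ≤ ε → |b (x, s) - b (y, s')| ≤ κ)
    (hcfl : 2 * (h * C * ν.real univ) ≤ 1) {γ' : ℝ}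
    (hγ' : D * γ + h * (D * (C * (2 * ν.real univ)) * ∫ z, levyWeight z ∂μ) ≤ γ')
    {ψ : Euc N → ℝ} (hψ : IsCc ψ) (hψ1 : ∀ x, |ψ x| ≤ 1) {t : ℝ} (ht : t ∈ Icc 0 T) {n : ℕ}
    (hn : n * h = t) :
    ∀ i : ℕ, i ≤ n → ∃ e : Euc N → ℝ, IsCc e ∧ (∀ x, |e x| ≤ 1) ∧
      (∫ x, u x t * moll ρ ψ x) + lam / (2 * κ) * jumpEnergy ν e ≤
        (∫ x, u x (t - i * h) * moll ρ e x)
        + (∫ s in (t - i * h)..t, (γ' * (∫ x, |φ (u x s)|) + 1 / (2 * lam) *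
          ∫ x, (2 * (φ (u x s) - b (x, s) * u x s) ^ 2 + 8 * κ ^ 2 * u x s ^ 2)))
        + lam / (2 * κ) * jumpEnergy ν ψ := by
  have hwabs : MemL1QT T fun x t => |φ (u x t)| := Integrable.abs hw
  have hmem : ∀ i : ℕ, i ≤ n → t - i * h ∈ Icc 0 T := fun i hi => by
    have h1 : (i : ℝ) * h ≤ n * h := by gcongr
    have h2 : 0 ≤ (i : ℝ) * h := by positivity
    exact ⟨by linarith, by linarith [ht.2]⟩
  intro i
  induction i with
  | zero => exact fun _ => ⟨ψ, hψ, hψ1, by simp⟩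
  | succ i ih =>
    intro hi
    obtain ⟨e, he, he1, hle⟩ := ih (by omega)
    have h0 := hmem (i + 1) hi
    have h1 := hmem i (by omega)
    have hd : t - i * h - (t - ((i + 1 : ℕ) : ℝ) * h) = h := by push_cast; ring
    obtain ⟨e', he', he1', hle'⟩ := husol.duality_step hT hμ hu1 hw huC hν hR htr hρ hD0 hD hb hb0
      hκ hbC hY hlam h0 h1 (by linarith) (fun x y s hs hxy => hosc x y s _ (by
        rw [abs_of_nonneg (by linarith [hs.1])]; linarith [hs.2]) hxy) (by rwa [hd])
        (γ' := γ') (by rwa [hd]) he he1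
    refine ⟨e', he', he1', ?_⟩
    have I : ∀ a ∈ Icc 0 T, ∀ b' ∈ Icc 0 T, IntervalIntegrable
        (fun s => γ' * (∫ x, |φ (u x s)|) + 1 / (2 * lam) *
          ∫ x, (2 * (φ (u x s) - b (x, s) * u x s) ^ 2 + 8 * κ ^ 2 * u x s ^ 2)) volume a b' :=
      fun a ha b' hb' => ((hwabs.intervalIntegrable hT ha hb').const_mul _).add
        ((hY.intervalIntegrable hT ha hb').const_mul _)
    rw [← intervalIntegral.integral_add_adjacent_intervals (I _ h0 _ h1) (I _ h1 _ ht)]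
    linarith

theorem MemL1QT.interval_integral_le {T : ℝ} (hT : 0 < T) {f : Euc N → ℝ → ℝ} (hf : MemL1QT T f)
    (h0 : ∀ x s, 0 ≤ f x s) {t : ℝ} (ht : t ∈ Icc 0 T) :
    ∫ s in (0 : ℝ)..t, ∫ x, f x s ≤ ∫ p, f p.1 p.2 ∂(QTvol N T) := by
  have h1 : ∫ p, f p.1 p.2 ∂(QTvol N T) = ∫ s in (0 : ℝ)..T, ∫ x, f x s := by
    rw [QTvol, integral_prod_symm _ hf, intervalIntegral.integral_of_le hT.le,
      integral_Ioc_eq_integral_Ioo]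
  rw [h1]
  have hm : (0 : ℝ) ∈ Icc 0 T := left_mem_Icc.2 hT.le
  refine intervalIntegral.integral_mono_interval le_rfl ht.1 ht.2
    (Eventually.of_forall fun s => integral_nonneg fun x => h0 x s)
    (hf.intervalIntegrable hT hm (right_mem_Icc.2 hT.le))

theorem exists_pos_abs_sub_le {α : Type*} [PseudoMetricSpace α] {f : α → ℝ} (hf : Continuous f)
    (hs : HasCompactSupport f) {σ : ℝ} (hσ : 0 < σ) :
    ∃ δ, 0 < δ ∧ ∀ x y, dist x y < δ → |f x - f y| ≤ σ := by
  have h := hf.uniformContinuous_of_tendsto_cocompact hs.is_zero_at_infty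
  obtain ⟨δ, hδ, h⟩ := Metric.uniformContinuous_iff.1 h σ hσ
  exact ⟨δ, hδ, fun x y hxy => (h hxy).le⟩

theorem IsCc.exists_integral_mul_le_moll {ψ : Euc N → ℝ} (hψ : IsCc ψ) {v : Euc N → ℝ}
    (hv : LocallyIntegrable v) :
    ∃ B, 0 ≤ B ∧ ∀ σ, 0 < σ → ∃ δ, 0 < δ ∧ ∀ (ρ : Euc N → ℝ) (ε : ℝ), IsMollifier ρ ε → ε ≤ δ →
      ∫ x, v x * ψ x ≤ (∫ x, v x * moll ρ ψ x) + σ * B := by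
  set K := Metric.cthickening 1 (tsupport ψ) with hK
  have hKc : IsCompact K := hψ.2.isCompact.cthickening
  refine ⟨∫ x in K, |v x|, by positivity, fun σ hσ => ?_⟩
  obtain ⟨δ, hδ, h⟩ := exists_pos_abs_sub_le hψ.1 hψ.2 hσ
  refine ⟨min (δ / 2) 1, by positivity, fun ρ ε hρ hε => ?_⟩
  have I : ∀ g : Euc N → ℝ, IsCc g → Integrable fun x => v x * g x := fun g hg => by
    simpa [mul_comm] using hv.integrable_smul_left_of_hasCompactSupport hg.1 hg.2
  have hm := (hρ.isTestFn_moll hψ).isCc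
  have hb : ∀ x, |moll ρ ψ x - ψ x| ≤ σ := fun x => hρ.abs_moll_sub_le hψ.1 x fun y hy =>
    h y x (by
      rw [dist_comm, dist_eq_norm]
      exact (hy.trans (hε.trans (min_le_left _ _))).trans_lt (by linarith))
  have hz : ∀ x, x ∉ K → moll ρ ψ x - ψ x = 0 := by
    intro x hx
    have h0 : ∀ y, ‖x - y‖ ≤ 1 → ψ y = 0 := by
      intro y hy
      by_contra hne
      refine hx (Metric.mem_cthickening_of_dist_le x y 1 _ (subset_tsupport _ hne) ?_)
      rwa [dist_eq_norm]
    have h1 := hρ.abs_moll_le hψ.1 (M := 0) x fun y hy => by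
      rw [h0 y (hy.trans (hε.trans (min_le_right _ _)))]; simp
    rw [h0 x (by simp), abs_nonpos_iff.1 h1, sub_zero]
  rw [← sub_le_iff_le_add', ← integral_sub (I _ hψ) (I _ hm), ← integral_const_mul,
    ← integral_indicator hKc.measurableSet]
  refine integral_mono ((I _ hψ).sub (I _ hm))
    ((integrable_indicator_iff hKc.measurableSet).2
      (((hv.integrableOn_isCompact hKc).abs).const_mul σ)) fun x => ?_
  dsimp only
  have e : v x * ψ x - v x * moll ρ ψ x = -(v x * (moll ρ ψ x - ψ x)) := by ring
  rw [e]
  by_cases hx : x ∈ K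
  · rw [indicator_of_mem hx, mul_comm σ]
    refine (neg_le_abs _).trans ?_
    rw [abs_mul]
    exact mul_le_mul_of_nonneg_left (hb x) (abs_nonneg _)
  · rw [indicator_of_notMem hx, hz x hx]; simp

theorem IsCc.jumpEnergy_le_of_abs_jumpOp_le {ν : Measure (Euc N)} {ψ : Euc N → ℝ} (hψ : IsCc ψ)
    {J : ℝ} (hJ : ∀ x, |jumpOp ν ψ x| ≤ J) : jumpEnergy ν ψ ≤ (∫ x, |ψ x|) * J := by
  rw [jumpEnergy]
  refine (neg_le_abs _).trans ?_
  rw [← Real.norm_eq_abs, ← integral_mul_const]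
  refine norm_integral_le_of_norm_le (hψ.integrable.abs.mul_const J)
    (Eventually.of_forall fun x => ?_)
  rw [Real.norm_eq_abs, abs_mul]
  exact mul_le_mul_of_nonneg_left (hJ x) (abs_nonneg _)

/-- The `L¹` norm is controlled by the initial one, tested against smooth functions. -/
theorem IsDistSolOp.integral_mul_le {T : ℝ} (hT : 0 < T) {μ : Measure (Euc N)}
    (hμ : IsLevyMeasure μ) {φ : ℝ → ℝ} {u0 : Euc N → ℝ} {u : Euc N → ℝ → ℝ}
    (hu0 : Integrable u0) (hu1 : MemL1QT T u) (hw : MemL1QT T (fun x t => φ (u x t)))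
    (huC : MemCL1loc T u) (husol : IsDistSolOp T (Lop μ) φ u0 u)
    (hu2 : MemL1QT T fun x t => u x t ^ 2) {A : ℝ} (hA0 : 0 ≤ A)
    (hwu : ∀ᵐ p ∂(QTvol N T), 0 ≤ φ (u p.1 p.2) * u p.1 p.2 ∧ |φ (u p.1 p.2)| ≤ A * |u p.1 p.2|)
    {ψ : Euc N → ℝ} (hψ : IsTestFn ψ) (hψ1 : ∀ x, |ψ x| ≤ 1) {t : ℝ} (ht : t ∈ Icc 0 T) :
    ∫ x, u x t * ψ x ≤ ∫ x, |u0 x| := by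
  obtain ⟨B, hB0, hB⟩ := hψ.isCc.exists_integral_mul_le_moll (huC.locallyIntegrable ht)
  obtain ⟨Kψ, hKψ0, hKψ⟩ := hψ.exists_levyRem_bound
  set Λ := ∫ z, levyWeight z ∂μ with hΛ
  have hΛ0 : 0 ≤ Λ := integral_nonneg levyWeight_nonneg
  set E := (∫ x, |ψ x|) * (Kψ * Λ) with hE
  have hE0 : 0 ≤ E := by positivity
  set U2 := ∫ p, u p.1 p.2 ^ 2 ∂(QTvol N T) with hU2
  set W1 := ∫ p, |φ (u p.1 p.2)| ∂(QTvol N T) with hW1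
  have hwabs : MemL1QT T fun x t => |φ (u x t)| := Integrable.abs hw
  have hm0 : (0 : ℝ) ∈ Icc 0 T := left_mem_Icc.2 hT.le
  suffices H : ∀ σ : ℝ, 0 < σ →
      ∫ x, u x t * ψ x ≤ (∫ x, |u0 x|) + σ * (B + W1 + 1 + 4 * U2 + E / 2) by
    have hlim : Tendsto (fun σ : ℝ => (∫ x, |u0 x|) + σ * (B + W1 + 1 + 4 * U2 + E / 2))
        (nhdsWithin 0 (Ioi 0)) (nhds ((∫ x, |u0 x|) + 0 * (B + W1 + 1 + 4 * U2 + E / 2))) :=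
      (Continuous.tendsto (by fun_prop) 0).mono_left nhdsWithin_le_nhds
    rw [zero_mul, add_zero] at hlim
    exact ge_of_tendsto hlim (eventually_nhdsWithin_of_forall fun σ hσ => H σ hσ)
  intro σ hσ
  obtain ⟨b, hb, hbs, hb0, hbi, hbκ⟩ := exists_coeff_approx hu1.aestronglyMeasurable hu2
    hw.aestronglyMeasurable hA0 hwu (κ := σ ^ 4) (by positivity)
  obtain ⟨δ₁, hδ₁, hosc⟩ := exists_pos_abs_sub_le hb hbs (σ := σ ^ 2) (by positivity)
  obtain ⟨δ₂, hδ₂, hmoll⟩ := hB σ hσ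
  have hε : 0 < min (δ₁ / 2) δ₂ := by positivity
  obtain ⟨ρ, hρ⟩ := exists_isMollifier (N := N) hε
  obtain ⟨D, hD0, hD⟩ := hρ.exists_levyRem_moll_bound
  obtain ⟨ν, hν, hfin, ⟨R, hR⟩, htr⟩ := hμ.exists_truncation (γ := σ / (2 * (D + 1))) (by positivity)
  obtain ⟨M, hM⟩ := hbs.exists_bound_of_continuous hb
  have hM' : ∀ p, b p ≤ M := fun p => (le_abs_self _).trans (hM p)
  have hM0 : 0 ≤ M := (norm_nonneg _).trans (hM 0)
  set C := M + σ ^ 2 with hC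
  have hC0 : 0 ≤ C := by positivity
  set m := ν.real univ with hm
  have hm0' : 0 ≤ m := measureReal_nonneg
  obtain ⟨n, hn⟩ := exists_nat_gt
    (t * (2 * (C * m) + 2 / σ * (D * (C * (2 * m)) * Λ) + 2 / δ₁))
  have ht0 := ht.1
  have hnpos : (0 : ℝ) < n := lt_of_le_of_lt (by positivity) hn
  set h := t / n with hh
  have hh0 : 0 ≤ h := by positivity
  have hQ : h * (2 * (C * m)) + h * (2 / σ * (D * (C * (2 * m)) * Λ)) + h * (2 / δ₁) ≤ 1 := by
    have : h * (2 * (C * m) + 2 / σ * (D * (C * (2 * m)) * Λ) + 2 / δ₁) ≤ 1 := by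
      rw [hh, div_mul_eq_mul_div, div_le_one hnpos]; exact hn.le
    linarith
  have hq1 : 0 ≤ h * (2 * (C * m)) := by positivity
  have hq2 : 0 ≤ h * (2 / σ * (D * (C * (2 * m)) * Λ)) := by positivity
  have hq3 : 0 ≤ h * (2 / δ₁) := by positivity
  have hhδ : h ≤ δ₁ / 2 := by
    have : h * (2 / δ₁) * (δ₁ / 2) ≤ 1 * (δ₁ / 2) := by gcongr; linarith
    rwa [mul_assoc, div_mul_div_comm, mul_comm 2 δ₁, div_self (by positivity), mul_one,
      one_mul] at this
  have hγ' : D * (σ / (2 * (D + 1))) + h * (D * (C * (2 * m)) * Λ) ≤ σ := by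
    have h1 : D * (σ / (2 * (D + 1))) ≤ σ / 2 := by
      rw [mul_div_assoc', div_le_div_iff₀ (by positivity) (by positivity)]; nlinarith
    have h2 : h * (2 / σ * (D * (C * (2 * m)) * Λ)) * (σ / 2) ≤ 1 * (σ / 2) := by
      gcongr; linarith
    have h3 : h * (2 / σ * (D * (C * (2 * m)) * Λ)) * (σ / 2) = h * (D * (C * (2 * m)) * Λ) := by
      field_simp
    linarith
  have hY : MemL1QT T fun x t =>
      2 * (φ (u x t) - b (x, t) * u x t) ^ 2 + 8 * (σ ^ 2) ^ 2 * u x t ^ 2 :=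
    (hbi.const_mul 2).add (Integrable.const_mul hu2 _)
  obtain ⟨e, he, he1, hle⟩ := husol.duality_iter hT hμ hu1 hw huC hν hR htr hρ hD0 hD hb hb0
    (κ := σ ^ 2) (C := C) (by positivity) (fun p => by linarith [hM' p]) hY (lam := σ ^ 3)
    (by positivity) hh0 (fun x y s s' hs hxy => hosc _ _ (by
      rw [Prod.dist_eq, max_lt_iff, dist_eq_norm, Real.dist_eq]
      have := hxy.trans (min_le_left _ _)
      exact ⟨by linarith, by linarith⟩)) (by linarith) hγ' hψ.isCc hψ1 ht (n := n)
    (by rw [hh]; field_simp) n le_rfl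
  have hnh : t - n * h = 0 := by rw [hh]; field_simp; simp
  rw [hnh] at hle
  have hme := hρ.isTestFn_moll he
  have k1 : ∫ x, u x 0 * moll ρ e x ≤ ∫ x, |u0 x| := by
    rw [husol.integral_mul_eq hT hμ hu1 hw huC hme 0 hm0, intervalIntegral.integral_same, add_zero]
    refine (le_abs_self _).trans ?_
    rw [← Real.norm_eq_abs]
    refine norm_integral_le_of_norm_le hu0.abs (Eventually.of_forall fun x => ?_)
    rw [Real.norm_eq_abs, abs_mul]
    exact mul_le_of_le_one_right (abs_nonneg _) (hρ.abs_moll_le he.1 x fun y _ => he1 y)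
  have k2 : ∫ s in (0 : ℝ)..t, (σ * (∫ x, |φ (u x s)|) + 1 / (2 * σ ^ 3) *
      ∫ x, (2 * (φ (u x s) - b (x, s) * u x s) ^ 2 + 8 * (σ ^ 2) ^ 2 * u x s ^ 2))
      ≤ σ * W1 + σ * (1 + 4 * U2) := by
    rw [intervalIntegral.integral_add ((hwabs.intervalIntegrable hT hm0 ht).const_mul _)
      ((hY.intervalIntegrable hT hm0 ht).const_mul _), intervalIntegral.integral_const_mul,
      intervalIntegral.integral_const_mul]
    have j1 := hwabs.interval_integral_le hT (fun x s => abs_nonneg _) ht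
    have j2 := hY.interval_integral_le hT (fun x s => by positivity) ht
    have j3 : ∫ p, (2 * (φ (u p.1 p.2) - b (p.1, p.2) * u p.1 p.2) ^ 2
        + 8 * (σ ^ 2) ^ 2 * u p.1 p.2 ^ 2) ∂(QTvol N T) ≤ 2 * σ ^ 4 + 8 * (σ ^ 2) ^ 2 * U2 := by
      rw [integral_add (hbi.const_mul 2) (Integrable.const_mul hu2 _), integral_const_mul,
        integral_const_mul]
      gcongr
    have j4 : 1 / (2 * σ ^ 3) * (2 * σ ^ 4 + 8 * (σ ^ 2) ^ 2 * U2) = σ * (1 + 4 * U2) := by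
      field_simp
      ring
    rw [← j4]
    gcongr
    exact j2.trans j3
  have k3 : σ ^ 3 / (2 * σ ^ 2) * jumpEnergy ν ψ ≤ σ * (E / 2) := by
    have := hψ.isCc.jumpEnergy_le_of_abs_jumpOp_le (ν := ν)
      fun x => (htr ψ Kψ hψ.isCc hKψ0 hKψ x).2
    calc σ ^ 3 / (2 * σ ^ 2) * jumpEnergy ν ψ ≤ σ ^ 3 / (2 * σ ^ 2) * E := by gcongr
      _ = σ * (E / 2) := by field_simp
  have k4 : 0 ≤ σ ^ 3 / (2 * σ ^ 2) * jumpEnergy ν e :=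
    mul_nonneg (by positivity) he.jumpEnergy_nonneg
  have k5 := hmoll ρ _ hρ (min_le_right _ _)
  linarith

theorem exists_cutoff {R : ℝ} (hR : 0 < R) : ∃ χ : Euc N → ℝ, IsTestFn χ ∧ (∀ x, 0 ≤ χ x) ∧
    (∀ x, χ x ≤ 1) ∧ ∀ x, ‖x‖ ≤ R → χ x = 1 := by
  let f : ContDiffBump (0 : Euc N) := ⟨R, R + 1, hR, by linarith⟩
  exact ⟨f, ⟨f.contDiff, f.hasCompactSupport⟩, fun x => f.nonneg, fun x => f.le_one,
    fun x hx => f.one_of_mem_closedBall (by simpa using hx)⟩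

theorem integral_mul_abs_le_of_forall_test {v : Euc N → ℝ} (hv : LocallyIntegrable v) {c : ℝ}
    (hc : ∀ ψ : Euc N → ℝ, IsTestFn ψ → (∀ x, |ψ x| ≤ 1) → ∫ x, v x * ψ x ≤ c)
    {χ : Euc N → ℝ} (hχ : IsTestFn χ) (hχ0 : ∀ x, 0 ≤ χ x) (hχ1 : ∀ x, χ x ≤ 1) :
    ∫ x, |v x| * χ x ≤ c := by
  suffices H : ∀ σ : ℝ, 0 < σ → ∫ x, |v x| * χ x ≤ c + σ * (2 + ∫ x, χ x) by
    have hlim : Tendsto (fun σ : ℝ => c + σ * (2 + ∫ x, χ x))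
        (nhdsWithin 0 (Ioi 0)) (nhds (c + 0 * (2 + ∫ x, χ x))) :=
      (Continuous.tendsto (by fun_prop) 0).mono_left nhdsWithin_le_nhds
    rw [zero_mul, add_zero] at hlim
    exact ge_of_tendsto hlim (eventually_nhdsWithin_of_forall fun σ hσ => H σ hσ)
  intro σ hσ
  have hK : IsCompact (tsupport χ) := hχ.2.isCompact
  set W := (tsupport χ).indicator v with hW
  have hWi : Integrable W :=
    (integrable_indicator_iff hK.measurableSet).2 (hv.integrableOn_isCompact hK)
  obtain ⟨U, hUs, hUc, hU⟩ := (memLp_one_iff_integrable.2 hWi).exist_eLpNorm_sub_le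
    ENNReal.one_ne_top le_rfl hσ
  have hUi : Integrable U := hUc.continuous.integrable_of_hasCompactSupport hUs
  have hWU : ∫ x, |W x - U x| ≤ σ := by
    rw [eLpNorm_one_eq_lintegral_enorm] at hU
    have := integral_norm_eq_lintegral_enorm (hWi.sub hUi).aestronglyMeasurable
    simp only [Pi.sub_apply, Real.norm_eq_abs] at this hU
    rw [this]
    exact ENNReal.toReal_le_of_le_ofReal hσ.le hU
  set r : Euc N → ℝ := fun x => √(U x ^ 2 + σ ^ 2) with hr
  have hr0 : ∀ x, 0 < r x := fun x => by positivity
  have hrU : ∀ x, |U x| ≤ r x := fun x => Real.abs_le_sqrt (by nlinarith [sq_nonneg σ])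
  have hrs : ContDiff ℝ (⊤ : ℕ∞) r :=
    ((hUc.pow 2).add contDiff_const).sqrt fun x => by positivity
  have hs1 : ∀ x, |U x / r x| ≤ 1 := fun x => by
    rw [abs_div, abs_of_pos (hr0 x), div_le_one (hr0 x)]; exact hrU x
  have hψ : IsTestFn fun x => U x / r x * χ x :=
    ⟨(hUc.div hrs fun x => (hr0 x).ne').mul hχ.1, hχ.2.mul_left⟩
  have hψ1 : ∀ x, |U x / r x * χ x| ≤ 1 := fun x => by
    rw [abs_mul, abs_of_nonneg (hχ0 x)]
    exact mul_le_one₀ (hs1 x) (hχ0 x) (hχ1 x)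
  have I : ∀ g : Euc N → ℝ, IsCc g → Integrable fun x => v x * g x := fun g hg => by
    simpa [mul_comm] using hv.integrable_smul_left_of_hasCompactSupport hg.1 hg.2
  have I' : Integrable fun x => |v x| * χ x := by
    have := (I χ hχ.isCc).abs
    simpa only [abs_mul, abs_of_nonneg (hχ0 _)] using this
  have hd : Integrable fun x => 2 * |W x - U x| := (hWi.sub hUi).abs.const_mul 2
  have hχi := hχ.isCc.integrable.const_mul σ
  have key : ∫ x, |v x| * χ x ≤
      (∫ x, v x * (U x / r x * χ x)) + 2 * (∫ x, |W x - U x|) + σ * ∫ x, χ x := by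
    have hsum : Integrable fun x => v x * (U x / r x * χ x) + 2 * |W x - U x| :=
      (I _ hψ.isCc).add hd
    rw [← integral_const_mul, ← integral_const_mul, ← integral_add (I _ hψ.isCc) hd,
      ← integral_add hsum hχi]
    refine integral_mono I' (hsum.add hχi) fun x => ?_
    dsimp only
    have hUs' : |U x| - σ ≤ U x * (U x / r x) := by
      rw [mul_div_assoc', le_div_iff₀ (hr0 x)]
      have h1 : r x ≤ |U x| + σ := by
        refine Real.sqrt_le_iff.2 ⟨by positivity, ?_⟩
        nlinarith [sq_abs (U x), abs_nonneg (U x)]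
      have h2 := hr0 x
      have h3 := sq_abs (U x)
      rcases le_total (|U x|) σ with h | h
      · nlinarith [mul_nonneg (sub_nonneg.2 h) h2.le, mul_self_nonneg (U x)]
      · nlinarith [mul_le_mul_of_nonneg_left h1 (sub_nonneg.2 h)]
    by_cases hx : x ∈ tsupport χ
    · have hWx : W x = v x := indicator_of_mem hx v
      rw [hWx]
      have h1 : -|v x - U x| ≤ (v x - U x) * (U x / r x * χ x) := by
        have := neg_abs_le ((v x - U x) * (U x / r x * χ x))
        rw [abs_mul] at this
        nlinarith [hψ1 x, abs_nonneg (v x - U x)]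
      have h2 : |v x| ≤ |v x - U x| + |U x| := by
        simpa using abs_add_le (v x - U x) (U x)
      have h3 : |v x| * χ x ≤ |v x - U x| + |U x| * χ x := by
        nlinarith [hχ0 x, hχ1 x, abs_nonneg (v x - U x)]
      nlinarith [hχ0 x]
    · have hχx : χ x = 0 := image_eq_zero_of_notMem_tsupport hx
      simp only [hχx, mul_zero, zero_add, add_zero]
      positivity
  have := hc _ hψ hψ1
  linarith

theorem integrable_of_forall_test {v : Euc N → ℝ} (hv : LocallyIntegrable v) {c : ℝ}
    (hc : ∀ ψ : Euc N → ℝ, IsTestFn ψ → (∀ x, |ψ x| ≤ 1) → ∫ x, v x * ψ x ≤ c) :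
    Integrable v := by
  have hcov : AECover (volume : Measure (Euc N)) atTop
      fun n : ℕ => Metric.closedBall (0 : Euc N) ((n : ℝ) + 1) :=
    aecover_closedBall (tendsto_atTop_add_const_right _ _ tendsto_natCast_atTop_atTop)
  refine hcov.integrable_of_integral_norm_bounded c
    (fun n => hv.integrableOn_isCompact (isCompact_closedBall _ _))
    (Eventually.of_forall fun n => ?_)
  obtain ⟨χ, hχ, hχ0, hχ1, hχe⟩ := exists_cutoff (N := N) (R := (n : ℝ) + 1) (by positivity)
  refine le_trans ?_ (integral_mul_abs_le_of_forall_test hv hc hχ hχ0 hχ1)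
  rw [← integral_indicator measurableSet_closedBall]
  have I : Integrable fun x => |v x| * χ x := by
    have := (hv.integrable_smul_left_of_hasCompactSupport hχ.1.continuous hχ.2).abs
    simpa only [smul_eq_mul, abs_mul, abs_of_nonneg (hχ0 _), mul_comm] using this
  refine integral_mono ((integrable_indicator_iff measurableSet_closedBall).2
    (hv.integrableOn_isCompact (isCompact_closedBall _ _)).norm) I fun x => ?_
  by_cases hx : x ∈ Metric.closedBall (0 : Euc N) ((n : ℝ) + 1)
  · rw [indicator_of_mem hx]
    simp [hχe x (by simpa using hx)]
  · rw [indicator_of_notMem hx]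
    exact mul_nonneg (abs_nonneg _) (hχ0 x)

theorem levyWeight_smul_le {a : ℝ} (ha0 : 0 ≤ a) (ha1 : a ≤ 1) (z : Euc N) :
    levyWeight (a • z) ≤ levyWeight z := by
  unfold levyWeight
  rw [norm_smul, Real.norm_eq_abs, abs_of_nonneg ha0]
  gcongr
  exact mul_le_of_le_one_left (norm_nonneg _) ha1

theorem abs_levyRem_comp_smul_le {χ : Euc N → ℝ} {K G : ℝ} (hK0 : 0 ≤ K) (hG0 : 0 ≤ G)
    (hK : ∀ x z, |levyRem χ x z| ≤ K * levyWeight z) (hG : ∀ x y, |χ x - χ y| ≤ G * ‖x - y‖)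
    (h0 : ∀ x, 0 ≤ χ x) (h1 : ∀ x, χ x ≤ 1) {a : ℝ} (ha0 : 0 ≤ a) (ha1 : a ≤ 1) (x z : Euc N) :
    |levyRem (fun y => χ (a • y)) x z|
      ≤ K * levyWeight (a • z) + levyWeight z * min (G * ‖a • z‖) 1 := by
  by_cases hz : ‖z‖ ≤ 1
  · have haz : ‖a • z‖ ≤ 1 := by
      rw [norm_smul, Real.norm_eq_abs, abs_of_nonneg ha0]
      exact mul_le_one₀ ha1 (norm_nonneg _) hz
    have e : levyRem (fun y => χ (a • y)) x z = levyRem χ (a • x) (a • z) := by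
      unfold levyRem
      rw [if_pos hz, if_pos haz, fderiv_comp_smul]
      simp [smul_add]
    rw [e]
    refine (hK _ _).trans (le_add_of_nonneg_right (mul_nonneg (levyWeight_nonneg _) ?_))
    exact le_min (by positivity) zero_le_one
  · have hw : levyWeight z = 1 := min_eq_right (one_le_pow₀ (not_le.1 hz).le)
    rw [hw, one_mul]
    refine le_add_of_nonneg_of_le (mul_nonneg hK0 (levyWeight_nonneg _)) ?_
    unfold levyRem
    rw [if_neg hz, sub_zero]
    refine le_min ?_ ?_
    · simpa [smul_add] using hG (a • (x + z)) (a • x)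
    · rw [abs_le]
      constructor <;> linarith [h0 (a • (x + z)), h0 (a • x), h1 (a • (x + z)), h1 (a • x)]

/-- Smooth cutoffs on which the Lévy operator is uniformly small. -/
theorem IsLevyMeasure.exists_cutoff_seq {μ : Measure (Euc N)} (hμ : IsLevyMeasure μ) :
    ∃ (X : ℕ → Euc N → ℝ) (η : ℕ → ℝ), (∀ n, IsTestFn (X n)) ∧ (∀ n x, |X n x| ≤ 1) ∧
      (∀ x, Tendsto (fun n => X n x) atTop (nhds 1)) ∧ Tendsto η atTop (nhds 0) ∧
      ∀ n x, |Lop μ (X n) x| ≤ η n := by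
  obtain ⟨χ, hχ, h0, h1, he⟩ := exists_cutoff (N := N) one_pos
  obtain ⟨K, hK0, hK⟩ := hχ.exists_levyRem_bound
  obtain ⟨G, hG⟩ := ContDiff.lipschitzWith_of_hasCompactSupport hχ.2 hχ.1 (by simp)
  have hG' : ∀ x y, |χ x - χ y| ≤ G * ‖x - y‖ := fun x y => by
    simpa [dist_eq_norm, Real.norm_eq_abs] using hG.dist_le_mul x y
  set a : ℕ → ℝ := fun n => 1 / ((n : ℝ) + 1) with ha
  have ha0 : ∀ n, 0 < a n := fun n => by positivity
  have ha1 : ∀ n, a n ≤ 1 := fun n => by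
    simp only [ha]; rw [div_le_one (by positivity)]; linarith [(n.cast_nonneg : (0 : ℝ) ≤ n)]
  have hal : Tendsto a atTop (nhds 0) := tendsto_one_div_add_atTop_nhds_zero_nat
  set F : ℕ → Euc N → ℝ := fun n z =>
    K * levyWeight (a n • z) + levyWeight z * min (G * ‖a n • z‖) 1 with hF
  have hF0 : ∀ n z, 0 ≤ F n z := fun n z => by
    have := levyWeight_nonneg z
    have := levyWeight_nonneg (a n • z)
    positivity
  have hFb : ∀ n z, F n z ≤ (K + 1) * levyWeight z := fun n z => by
    have h2 := mul_le_mul_of_nonneg_left (levyWeight_smul_le (ha0 n).le (ha1 n) z) hK0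
    have h3 := mul_le_mul_of_nonneg_left (min_le_right (G * ‖a n • z‖) 1) (levyWeight_nonneg z)
    simp only [hF]
    linarith
  have hFc : ∀ n, Continuous (F n) := fun n => by
    have h2 := continuous_levyWeight (N := N)
    have h3 : Continuous fun z : Euc N => levyWeight (a n • z) := h2.comp (by fun_prop)
    fun_prop
  have hdom := hμ.integrable_levyWeight.const_mul (K + 1)
  have hFn : ∀ n z, ‖F n z‖ ≤ (K + 1) * levyWeight z := fun n z => by
    rw [Real.norm_eq_abs, abs_of_nonneg (hF0 n z)]; exact hFb n z
  refine ⟨fun n x => χ (a n • x), fun n => ∫ z, F n z ∂μ, fun n => ⟨?_, ?_⟩, fun n x => ?_,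
    fun x => ?_, ?_, fun n x => ?_⟩
  · exact hχ.1.comp (contDiff_const_smul _)
  · exact hχ.2.comp_homeomorph (Homeomorph.smulOfNeZero (a n) (ha0 n).ne')
  · rw [abs_of_nonneg (h0 _)]; exact h1 _
  · have hl : Tendsto (fun n => a n • x) atTop (nhds 0) := by
      simpa using hal.smul_const x
    have := (hχ.1.continuous.tendsto 0).comp hl
    rwa [he 0 (by simp)] at this
  · have := tendsto_integral_of_dominated_convergence (μ := μ) (F := F) (f := fun _ => 0) _
      (fun n => (hFc n).aestronglyMeasurable) hdom
      (fun n => Eventually.of_forall (hFn n)) (Eventually.of_forall fun z => ?_)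
    · simpa using this
    · have hl : Tendsto (fun n => a n • z) atTop (nhds 0) := by
        simpa using hal.smul_const z
      have hc : Continuous fun y : Euc N => K * levyWeight y + levyWeight z * min (G * ‖y‖) 1 := by
        have h2 := continuous_levyWeight (N := N)
        fun_prop
      have h0' : K * levyWeight (0 : Euc N) + levyWeight z * min (G * ‖(0 : Euc N)‖) 1 = 0 := by
        simp [levyWeight]
      have := (hc.tendsto 0).comp hl
      rwa [h0'] at this
  · rw [Lop_eq_integral_levyRem, ← Real.norm_eq_abs]
    refine norm_integral_le_of_norm_le (hdom.mono' (hFc n).aestronglyMeasurable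
      (Eventually.of_forall (hFn n))) (Eventually.of_forall fun z => ?_)
    exact abs_levyRem_comp_smul_le hK0 G.2 hK hG' h0 h1 (ha0 n).le (ha1 n) x z

theorem tendsto_integral_mul_cutoff {v : Euc N → ℝ} (hv : Integrable v) {X : ℕ → Euc N → ℝ}
    (hX : ∀ n, IsTestFn (X n)) (hX1 : ∀ n x, |X n x| ≤ 1)
    (hXl : ∀ x, Tendsto (fun n => X n x) atTop (nhds 1)) :
    Tendsto (fun n => ∫ x, v x * X n x) atTop (nhds (∫ x, v x)) := by
  refine tendsto_integral_of_dominated_convergence (fun x => ‖v x‖)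
    (fun n => hv.aestronglyMeasurable.mul (hX n).1.continuous.aestronglyMeasurable) hv.norm
    (fun n => Eventually.of_forall fun x => ?_) (Eventually.of_forall fun x => ?_)
  · rw [norm_mul]
    exact mul_le_of_le_one_right (norm_nonneg _) (hX1 n x)
  · simpa using (hXl x).const_mul (v x)

theorem IsDistSolOp.integral_eq {T : ℝ} (hT : 0 < T) {μ : Measure (Euc N)}
    (hμ : IsLevyMeasure μ) {φ : ℝ → ℝ} {u0 : Euc N → ℝ} {u : Euc N → ℝ → ℝ}
    (hu0 : Integrable u0) (hu1 : MemL1QT T u) (hw : MemL1QT T (fun x t => φ (u x t)))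
    (huC : MemCL1loc T u) (husol : IsDistSolOp T (Lop μ) φ u0 u) {t : ℝ} (ht : t ∈ Icc 0 T)
    (hut : Integrable fun x => u x t) : ∫ x, u x t = ∫ x, u0 x := by
  obtain ⟨X, η, hX, hX1, hXl, hη, hL⟩ := hμ.exists_cutoff_seq
  have hm0 : (0 : ℝ) ∈ Icc 0 T := left_mem_Icc.2 hT.le
  have hwabs : MemL1QT T fun x t => |φ (u x t)| := Integrable.abs hw
  have hbound : ∀ n, ‖∫ s in (0 : ℝ)..t, ∫ x, φ (u x s) * Lop μ (X n) x‖
      ≤ (∫ s in (0 : ℝ)..t, ∫ x, |φ (u x s)|) * η n := fun n => by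
    rw [← intervalIntegral.integral_mul_const]
    refine intervalIntegral.norm_integral_le_of_norm_le ht.1 ?_
      ((hwabs.intervalIntegrable hT hm0 ht).mul_const _)
    filter_upwards [(ae_restrict_iff' measurableSet_Icc).1
      (ae_Icc_of_ae_Ioo hm0 ht hwabs.ae_integrable)] with s hs hs'
    rw [← integral_mul_const]
    refine norm_integral_le_of_norm_le ((hs (Ioc_subset_Icc_self hs')).mul_const _)
      (Eventually.of_forall fun x => ?_)
    rw [norm_mul]
    exact mul_le_mul_of_nonneg_left (hL n x) (norm_nonneg _)
  have hlim : Tendsto (fun n => ∫ s in (0 : ℝ)..t, ∫ x, φ (u x s) * Lop μ (X n) x) atTop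
      (nhds 0) := squeeze_zero_norm hbound (by simpa using hη.const_mul _)
  have h1 := tendsto_integral_mul_cutoff hut hX hX1 hXl
  have h2 := (tendsto_integral_mul_cutoff hu0 hX hX1 hXl).add hlim
  rw [add_zero] at h2
  refine tendsto_nhds_unique h1 (h2.congr fun n => ?_)
  exact (husol.integral_mul_eq hT hμ hu1 hw huC (hX n) t ht).symm

/-- A monotone function with linear growth at `0` has linear growth on bounded sets. -/
theorem exists_linear_bound {φ : ℝ → ℝ} (hφm : Monotone φ) {L δ : ℝ} (hδ : 0 < δ)
    (hL : 0 < L) (hφ : ∀ r, |r| ≤ δ → |φ r| ≤ L * |r|) (M : ℝ) :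
    ∃ A, 0 ≤ A ∧ ∀ r, |r| ≤ M → |φ r| ≤ A * |r| := by
  set S := max |φ M| |φ (-M)| with hS
  have hS0 : 0 ≤ S := le_max_of_le_left (abs_nonneg _)
  refine ⟨max L (S / δ), le_max_of_le_left hL.le, fun r hr => ?_⟩
  rcases le_total |r| δ with h | h
  · exact (hφ r h).trans (mul_le_mul_of_nonneg_right (le_max_left _ _) (abs_nonneg _))
  · have h1 : |φ r| ≤ S := by
      rw [hS, max_comm]
      exact abs_le_max_abs_abs (hφm (abs_le.1 hr).1) (hφm (abs_le.1 hr).2)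
    calc |φ r| ≤ S := h1
      _ = S / δ * δ := by field_simp
      _ ≤ S / δ * |r| := by gcongr
      _ ≤ _ := mul_le_mul_of_nonneg_right (le_max_right _ _) (abs_nonneg _)

theorem Monotone.mul_self_nonneg_of_map_zero {φ : ℝ → ℝ} (hφm : Monotone φ) (h0 : φ 0 = 0)
    (r : ℝ) : 0 ≤ φ r * r := by
  rcases le_total 0 r with h | h
  · exact mul_nonneg (h0 ▸ hφm h) h
  · exact mul_nonneg_of_nonpos_of_nonpos (h0 ▸ hφm h) h

end

/-- Mass conservation (Theorem 2.6 (f)). If `|φ(r)| ≤ L|r|` for `|r| ≤ δ`,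
then `∫ u(x,t) dx = ∫ u₀(x) dx` for every `t ∈ [0,T]`. -/
theorem mass_conservation
    (N : ℕ) (hN : 0 < N) (T : ℝ) (hT : 0 < T)
    (φ : ℝ → ℝ) (hφc : Continuous φ) (hφm : Monotone φ)
    (μ : Measure (Euc N)) (hμ : IsLevyMeasure μ)
    (u0 : Euc N → ℝ)
    (hu0inf : MemLinfRn u0) (hu01 : Integrable u0 (volume : Measure (Euc N)))
    (u : Euc N → ℝ → ℝ)
    (huinf : MemLinfQT T u) (hu1 : MemL1QT T u) (huC : MemCL1loc T u)
    (husol : IsDistSolOp T (Lop μ) φ u0 u)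
    (L δ : ℝ) (hL : 0 < L) (hδ : 0 < δ)
    (hφlin : ∀ r : ℝ, |r| ≤ δ → |φ r| ≤ L * |r|) :
    ∀ t ∈ Set.Icc (0 : ℝ) T, ∫ x, u x t = ∫ x, u0 x := by
  obtain ⟨M, hM⟩ := huinf.2
  obtain ⟨A, hA0, hA⟩ := exists_linear_bound hφm hδ hL hφlin M
  have hφ0 : φ 0 = 0 := by simpa using hφlin 0 (by simpa using hδ.le)
  have hwu : ∀ᵐ p ∂(QTvol N T), 0 ≤ φ (u p.1 p.2) * u p.1 p.2 ∧
      |φ (u p.1 p.2)| ≤ A * |u p.1 p.2| := by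
    filter_upwards [hM] with p hp
    exact ⟨hφm.mul_self_nonneg_of_map_zero hφ0 _, hA _ hp⟩
  have hw : MemL1QT T fun x t => φ (u x t) :=
    (Integrable.const_mul (Integrable.abs hu1) A).mono'
      (hφc.comp_aestronglyMeasurable huinf.1) (hwu.mono fun p hp => hp.2)
  have hu2 : MemL1QT T fun x t => u x t ^ 2 := by
    refine (Integrable.mul_bdd (c := M) hu1 huinf.1 hM).congr (Eventually.of_forall fun p => ?_)
    exact (pow_two _).symm
  intro t ht
  exact husol.integral_eq hT hμ hu01 hu1 hw huC ht
    (integrable_of_forall_test (huC.locallyIntegrable ht) fun ψ hψ hψ1 =>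
      husol.integral_mul_le hT hμ hu01 hu1 hw huC hu2 hA0 hwu hψ hψ1 ht)
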